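/- arXiv:2505.23384 — 2 statements merged into one kernel-verified Lean document; each statement's English description precedes it below -/
import Mathlib

section
/- There exist ε₀ > 0 and a constant K > 0 such that for every ε ∈ (0, ε₀) the following holds. For every γ > 0 there exist β > 0 and n₀ ∈ ℕ such that for all n ≥ n₀, all d with 1 + ε ≤ d ≤ β·n, and every (n,d,λ)-graph G with λ/d ≤ ε^{24/ε^{12}}: setting p = (1+ε)/d, with probability at least 1 − γ the excess of the p-site-percolated subgraph G_p satisfies exc(G_p) ≤ K·ε³·n/d. -/
open Finset

/-- The adjacency matrix of `G` over `ℝ` is Hermitian. -/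
noncomputable def SimpleGraph.adjHermitian {n : ℕ} (G : SimpleGraph (Fin n)) :
    letI := Classical.decRel G.Adj
    ((G.adjMatrix ℝ).IsHermitian) := by
  letI := Classical.decRel G.Adj
  rw [Matrix.IsHermitian, Matrix.conjTranspose_eq_transpose_of_trivial]
  exact G.isSymm_adjMatrix

/-- `G` is an `(n,d,λ)`-graph: a `d`-regular graph on `n` vertices all of whose
adjacency-matrix eigenvalues, except one eigenvalue equal to `d`, have absolute
value at most `lam`. -/
noncomputable def IsNDLGraph (n d : ℕ) (lam : ℝ) (G : SimpleGraph (Fin n)) : Prop :=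
  letI := Classical.decRel G.Adj
  G.IsRegularOfDegree d ∧
    ∃ i₀ : Fin n, (G.adjHermitian.eigenvalues i₀ = d ∧
      ∀ i : Fin n, i ≠ i₀ → |G.adjHermitian.eigenvalues i| ≤ lam)

/-- `G` has an induced path on `k` vertices. -/
def HasInducedPath {V : Type*} (G : SimpleGraph V) (k : ℕ) : Prop :=
  ∃ f : Fin k → V, Function.Injective f ∧
    ∀ i j : Fin k, G.Adj (f i) (f j) ↔ ((i : ℕ) + 1 = (j : ℕ) ∨ (j : ℕ) + 1 = (i : ℕ))

/-- `G` has an induced cycle of length `k`. -/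
def HasInducedCycle {V : Type*} (G : SimpleGraph V) (k : ℕ) : Prop :=
  3 ≤ k ∧ ∃ f : ZMod k → V, Function.Injective f ∧
    ∀ i j : ZMod k, G.Adj (f i) (f j) ↔ (i - j = 1 ∨ j - i = 1)

open MeasureTheory in
/-- The Bernoulli measure on `Bool` with success probability `p`. -/
noncomputable def bernoulliMeasure (p : ℝ) : Measure Bool :=
  (ENNReal.ofReal p) • Measure.dirac true + (ENNReal.ofReal (1 - p)) • Measure.dirac false

open MeasureTheory in
/-- The site-percolation measure on subsets of `V` (encoded as functions `V → Bool`):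
every vertex is retained independently with probability `p`. -/
noncomputable def percolationMeasure (V : Type*) [Fintype V] (p : ℝ) :
    Measure (V → Bool) :=
  Measure.pi fun _ : V => bernoulliMeasure p

/-- The vertex set retained by the percolation outcome `ω`. -/
def percSet {V : Type*} (ω : V → Bool) : Set V := {v : V | ω v = true}

noncomputable def bernoulliWeight (p : ℝ) (b : Bool) : ℝ := if b then p else 1 - p

noncomputable def percolationWeight {V : Type*} [Fintype V] (p : ℝ) (ω : V → Bool) : ℝ :=
  ∏ v, bernoulliWeight p (ω v)

/-- The expectation of `f` under Bernoulli site percolation with parameter `p`. -/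
noncomputable def percolationExp {V : Type*} [Fintype V] [DecidableEq V] (p : ℝ)
    (f : (V → Bool) → ℝ) : ℝ :=
  ∑ ω, percolationWeight p ω * f ω

open Classical in
/-- The real-valued indicator of a proposition. -/
noncomputable def propIndicator (P : Prop) : ℝ := if P then 1 else 0

theorem propIndicator_of_true {P : Prop} (h : P) : propIndicator P = 1 := if_pos h

theorem propIndicator_of_false {P : Prop} (h : ¬P) : propIndicator P = 0 := if_neg h

theorem propIndicator_nonneg (P : Prop) : 0 ≤ propIndicator P := by
  unfold propIndicator; split_ifs <;> norm_num

theorem propIndicator_le_one (P : Prop) : propIndicator P ≤ 1 := by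
  unfold propIndicator; split_ifs <;> norm_num

theorem propIndicator_mono {P Q : Prop} (h : P → Q) : propIndicator P ≤ propIndicator Q := by
  unfold propIndicator; split_ifs <;> first | tauto | norm_num

theorem propIndicator_and (P Q : Prop) :
    propIndicator (P ∧ Q) = propIndicator P * propIndicator Q := by
  unfold propIndicator; split_ifs <;> first | tauto | norm_num

theorem propIndicator_or_le (P Q : Prop) :
    propIndicator (P ∨ Q) ≤ propIndicator P + propIndicator Q := by
  unfold propIndicator; split_ifs <;> first | tauto | norm_num

theorem bernoulliWeight_nonneg {p : ℝ} (h0 : 0 ≤ p) (h1 : p ≤ 1) (b : Bool) :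
    0 ≤ bernoulliWeight p b := by
  unfold bernoulliWeight; split_ifs <;> linarith

section General

variable {V : Type*} [Fintype V] [DecidableEq V] {p : ℝ}

omit [DecidableEq V] in
theorem percolationWeight_nonneg (h0 : 0 ≤ p) (h1 : p ≤ 1) (ω : V → Bool) :
    0 ≤ percolationWeight p ω :=
  prod_nonneg fun _ _ => bernoulliWeight_nonneg h0 h1 _

theorem percolationExp_add (f g : (V → Bool) → ℝ) :
    percolationExp p (fun ω => f ω + g ω) = percolationExp p f + percolationExp p g := by
  simp [percolationExp, mul_add, sum_add_distrib]

theorem percolationExp_sub (f g : (V → Bool) → ℝ) :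
    percolationExp p (fun ω => f ω - g ω) = percolationExp p f - percolationExp p g := by
  simp [percolationExp, mul_sub, sum_sub_distrib]

theorem percolationExp_const_mul (c : ℝ) (f : (V → Bool) → ℝ) :
    percolationExp p (fun ω => c * f ω) = c * percolationExp p f := by
  simp only [percolationExp, mul_sum]
  exact sum_congr rfl fun _ _ => by ring

theorem percolationExp_sum {ι : Type*} (s : Finset ι) (f : ι → (V → Bool) → ℝ) :
    percolationExp p (fun ω => ∑ i ∈ s, f i ω) = ∑ i ∈ s, percolationExp p (f i) := by
  simp only [percolationExp, mul_sum]
  exact sum_comm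

theorem percolationExp_mono (h0 : 0 ≤ p) (h1 : p ≤ 1) {f g : (V → Bool) → ℝ}
    (h : ∀ ω, f ω ≤ g ω) : percolationExp p f ≤ percolationExp p g :=
  sum_le_sum fun ω _ => mul_le_mul_of_nonneg_left (h ω) (percolationWeight_nonneg h0 h1 ω)

theorem percolationExp_nonneg (h0 : 0 ≤ p) (h1 : p ≤ 1) {f : (V → Bool) → ℝ}
    (h : ∀ ω, 0 ≤ f ω) : 0 ≤ percolationExp p f :=
  sum_nonneg fun ω _ => mul_nonneg (percolationWeight_nonneg h0 h1 ω) (h ω)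

theorem sum_percolationWeight : ∑ ω : V → Bool, percolationWeight p ω = 1 := by
  have := (Fintype.prod_sum (fun (_ : V) (b : Bool) => bernoulliWeight p b)).symm
  unfold percolationWeight
  rw [this]
  simp [bernoulliWeight]

theorem percolationExp_const (c : ℝ) : percolationExp p (fun _ : V → Bool => c) = c := by
  simp [percolationExp, ← sum_mul, sum_percolationWeight]

theorem sum_mul_prod_erase (v : V) (φ : Bool → ℝ) (g : (V → Bool) → ℝ) :
    ∑ ω, φ (ω v) * (∏ u ∈ univ.erase v, bernoulliWeight p (ω u)) * g ω =
      percolationExp p (fun ω =>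
        φ true * g (Function.update ω v true) + φ false * g (Function.update ω v false)) := by
  have key : ∀ (ψ : Bool → ℝ) (h : (V → Bool) → ℝ),
      ∑ ω, ψ (ω v) * (∏ u ∈ univ.erase v, bernoulliWeight p (ω u)) * h ω =
        ∑ η : {u // u ≠ v} → Bool, (∏ u, bernoulliWeight p (η u)) *
          (ψ true * h ((Equiv.funSplitAt v Bool).symm (true, η)) +
            ψ false * h ((Equiv.funSplitAt v Bool).symm (false, η))) := by
    intro ψ h
    rw [← (Equiv.funSplitAt v Bool).symm.sum_comp, Fintype.sum_prod_type, Fintype.sum_bool,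
      ← sum_add_distrib]
    refine sum_congr rfl fun η _ => ?_
    have hw : ∀ b, ∏ u ∈ univ.erase v,
        bernoulliWeight p ((Equiv.funSplitAt v Bool).symm (b, η) u) =
          ∏ u, bernoulliWeight p (η u) := by
      intro b
      rw [← prod_subtype (univ.erase v) (p := fun u => u ≠ v) (by simp)
        (fun u => bernoulliWeight p ((Equiv.funSplitAt v Bool).symm (b, η) u)) |>.symm]
      refine prod_congr rfl fun u _ => ?_
      simp [Equiv.funSplitAt, Equiv.piSplitAt, u.2]
    have hv : ∀ b, (Equiv.funSplitAt v Bool).symm (b, η) v = b := by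
      simp [Equiv.funSplitAt, Equiv.piSplitAt]
    rw [hw, hw, hv, hv]
    ring
  have hupd : ∀ b b' η, Function.update ((Equiv.funSplitAt v Bool).symm (b, η)) v b' =
      (Equiv.funSplitAt v Bool).symm (b', η) := by
    intro b b' η
    ext u
    by_cases hu : u = v
    · subst hu; simp [Equiv.funSplitAt, Equiv.piSplitAt]
    · simp [Equiv.funSplitAt, Equiv.piSplitAt, hu]
  have hw : ∀ ω : V → Bool, percolationWeight p ω =
      bernoulliWeight p (ω v) * ∏ u ∈ univ.erase v, bernoulliWeight p (ω u) := fun ω =>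
    (mul_prod_erase univ (fun u => bernoulliWeight p (ω u)) (mem_univ v)).symm
  unfold percolationExp
  simp only [hw]
  rw [key, key]
  refine sum_congr rfl fun η _ => ?_
  have hsum : bernoulliWeight p true + bernoulliWeight p false = 1 := by simp [bernoulliWeight]
  simp only [hupd, ← add_mul, hsum, one_mul]

/-- Resampling the state of a single vertex does not change expectations. -/
theorem percolationExp_resample (v : V) (f : (V → Bool) → ℝ) :
    percolationExp p f = percolationExp p (fun ω =>
      p * f (Function.update ω v true) + (1 - p) * f (Function.update ω v false)) := by
  have h := sum_mul_prod_erase (p := p) v (bernoulliWeight p) f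
  simp only [bernoulliWeight, if_true, Bool.false_eq_true, if_false] at h
  rw [← h]
  exact sum_congr rfl fun ω _ => by
    rw [percolationWeight, ← mul_prod_erase univ _ (mem_univ v)]; rfl

/-- The state of `v` is independent of a function that ignores it. -/
theorem percolationExp_open_mul (v : V) (f : (V → Bool) → ℝ)
    (hf : ∀ ω b, f (Function.update ω v b) = f ω) :
    percolationExp p (fun ω => propIndicator (ω v = true) * f ω) = p * percolationExp p f := by
  rw [percolationExp_resample v, ← percolationExp_const_mul]
  simp [hf, propIndicator]

theorem percolationExp_open (v : V) :
    percolationExp p (fun ω => propIndicator (ω v = true)) = p := by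
  have := percolationExp_open_mul (p := p) v (fun _ => 1) (fun _ _ => rfl)
  simpa [percolationExp_const] using this

/-- Positive association: two increasing functions are positively correlated. -/
theorem percolationExp_mul_le (h0 : 0 ≤ p) (h1 : p ≤ 1) {f g : (V → Bool) → ℝ}
    (hf0 : ∀ ω, 0 ≤ f ω) (hg0 : ∀ ω, 0 ≤ g ω) (hf : Monotone f) (hg : Monotone g) :
    percolationExp p f * percolationExp p g ≤ percolationExp p (fun ω => f ω * g ω) := by
  have hμ : ∀ a b : V → Bool, percolationWeight p a * percolationWeight p b ≤
      percolationWeight p (a ⊓ b) * percolationWeight p (a ⊔ b) := by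
    intro a b
    unfold percolationWeight
    rw [← prod_mul_distrib, ← prod_mul_distrib]
    refine le_of_eq (prod_congr rfl fun v _ => ?_)
    rw [Pi.inf_apply, Pi.sup_apply]
    cases a v <;> cases b v <;> simp [mul_comm]
  have := fkg f g (percolationWeight p) (fun ω => percolationWeight_nonneg h0 h1 ω) hf0 hg0 hf hg hμ
  rw [sum_percolationWeight, one_mul] at this
  exact this

/-- For increasing functions with values in `[0, 1]`, the expectation of the product of the
complements is at least the product of the expectations. -/
theorem prod_one_sub_percolationExp_le (h0 : 0 ≤ p) (h1 : p ≤ 1) {ι : Type*} (s : Finset ι)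
    (f : ι → (V → Bool) → ℝ) (hf0 : ∀ i ω, 0 ≤ f i ω) (hf1 : ∀ i ω, f i ω ≤ 1)
    (hf : ∀ i, Monotone (f i)) :
    ∏ i ∈ s, (1 - percolationExp p (f i)) ≤
      percolationExp p (fun ω => ∏ i ∈ s, (1 - f i ω)) := by
  classical
  induction s using Finset.induction_on with
  | empty => simp [percolationExp_const]
  | insert a s ha ih =>
    simp only [prod_insert ha]
    have hE : percolationExp p (f a) ≤ 1 := by
      have := percolationExp_mono h0 h1 (hf1 a)
      rwa [percolationExp_const] at this
    have hprod0 : ∀ ω, 0 ≤ ∏ i ∈ s, (1 - f i ω) := fun ω =>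
      prod_nonneg fun i _ => sub_nonneg.2 (hf1 i ω)
    have hprod1 : ∀ ω, ∏ i ∈ s, (1 - f i ω) ≤ 1 := fun ω =>
      prod_le_one (fun i _ => sub_nonneg.2 (hf1 i ω)) fun i _ => sub_le_self _ (hf0 i ω)
    have hcorr := percolationExp_mul_le h0 h1 (f := f a)
      (g := fun ω => 1 - ∏ i ∈ s, (1 - f i ω)) (hf0 a) (fun ω => sub_nonneg.2 (hprod1 ω)) (hf a)
      (fun ω η h => sub_le_sub_left (prod_le_prod (fun i _ => sub_nonneg.2 (hf1 i η))
        fun i _ => sub_le_sub_left (hf i h) _) _)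
    have hid : percolationExp p (fun ω => (1 - f a ω) * ∏ i ∈ s, (1 - f i ω)) =
        percolationExp p (fun ω => ∏ i ∈ s, (1 - f i ω)) - percolationExp p (f a) +
          percolationExp p (fun ω => f a ω * (1 - ∏ i ∈ s, (1 - f i ω))) := by
      rw [← percolationExp_sub, ← percolationExp_add]
      congr 1; ext ω; ring
    rw [percolationExp_sub, percolationExp_const] at hcorr
    rw [hid]
    nlinarith [mul_le_mul_of_nonneg_left ih (sub_nonneg.2 hE)]

/-- Russo's formula. -/
theorem hasDerivAt_percolationExp (f : (V → Bool) → ℝ) (p : ℝ) :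
    HasDerivAt (fun s => percolationExp s f)
      (∑ v, percolationExp p (fun ω =>
        f (Function.update ω v true) - f (Function.update ω v false))) p := by
  have hw : ∀ b : Bool, HasDerivAt (fun s => bernoulliWeight s b) (if b then 1 else -1) p := by
    intro b
    cases b
    · simpa [bernoulliWeight] using (hasDerivAt_id' p).const_sub 1
    · simpa [bernoulliWeight] using hasDerivAt_id' p
  have h1 : HasDerivAt (fun s => percolationExp s f)
      (∑ ω : V → Bool, (∑ v, (∏ u ∈ univ.erase v, bernoulliWeight p (ω u)) •
        (if ω v then (1 : ℝ) else -1)) * f ω) p := by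
    unfold percolationExp percolationWeight
    exact HasDerivAt.fun_sum fun ω _ =>
      (HasDerivAt.fun_finsetProd fun v _ => hw (ω v)).mul_const _
  convert h1 using 1
  simp only [sum_mul]
  rw [sum_comm]
  refine sum_congr rfl fun v _ => ?_
  have h := sum_mul_prod_erase (p := p) v (fun b => if b then 1 else -1) f
  simp only [if_true, Bool.false_eq_true, if_false, one_mul, neg_one_mul, ← sub_eq_add_neg] at h
  rw [← h]
  exact sum_congr rfl fun ω _ => by rw [smul_eq_mul]; ring

end General

section Fin

variable {n : ℕ} {p : ℝ}

theorem percolationExp_succ (f : (Fin (n + 1) → Bool) → ℝ) :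
    percolationExp p f = p * percolationExp p (fun η => f (Fin.cons true η)) +
      (1 - p) * percolationExp p (fun η => f (Fin.cons false η)) := by
  unfold percolationExp percolationWeight
  rw [← (Fin.consEquiv fun _ => Bool).sum_comp, Fintype.sum_prod_type, Fintype.sum_bool,
    mul_sum, mul_sum]
  simp only [Fin.consEquiv, Equiv.coe_fn_mk, Fin.prod_univ_succ, Fin.cons_zero, Fin.cons_succ,
    bernoulliWeight, if_true, Bool.false_eq_true, if_false, mul_assoc]

theorem cons_inf_cons (b c : Bool) (η ξ : Fin n → Bool) :
    (Fin.cons b η : Fin (n + 1) → Bool) ⊓ Fin.cons c ξ = Fin.cons (b ⊓ c) (η ⊓ ξ) := by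
  ext i
  refine Fin.cases ?_ (fun j => ?_) i <;> simp

theorem compl_cons (b : Bool) (η : Fin n → Bool) :
    (Fin.cons b η : Fin (n + 1) → Bool)ᶜ = Fin.cons (bᶜ) (ηᶜ) := by
  ext i
  refine Fin.cases ?_ (fun j => ?_) i <;> simp

theorem cons_le_cons {b c : Bool} {η ξ : Fin n → Bool} (h : b ≤ c) (h' : η ≤ ξ) :
    (Fin.cons b η : Fin (n + 1) → Bool) ≤ Fin.cons c ξ := by
  intro i
  refine Fin.cases ?_ (fun j => ?_) i
  · simpa using h
  · simpa using h' j

/-- A van den Berg–Kesten type inequality: if `F` is an increasing property of pairs of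
configurations, then `F` is at most as likely to occur on disjoint parts of one configuration as
on two independent configurations. -/
theorem percolationExp_disjoint_le (h0 : 0 ≤ p) (h1 : p ≤ 1) :
    ∀ {n : ℕ} (F : (Fin n → Bool) → (Fin n → Bool) → Prop),
      (∀ x x' y y', x ≤ x' → y ≤ y' → F x y → F x' y') →
      percolationExp p (fun ω => propIndicator (∃ s, F (ω ⊓ s) (ω ⊓ sᶜ))) ≤
        percolationExp p (fun ω => percolationExp p (fun η => propIndicator (F ω η))) := by
  intro n
  induction n with
  | zero =>
    intro F _
    have hx : ∀ x : Fin 0 → Bool, x = default := fun x => Subsingleton.elim _ _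
    have hl : ∀ ω : Fin 0 → Bool, propIndicator (∃ s, F (ω ⊓ s) (ω ⊓ sᶜ)) ≤
        propIndicator (F default default) := by
      refine fun ω => propIndicator_mono ?_
      rintro ⟨s, hs⟩
      rwa [hx (ω ⊓ s), hx (ω ⊓ sᶜ)] at hs
    have hr : ∀ ω η : Fin 0 → Bool, propIndicator (F default default) ≤
        propIndicator (F ω η) := by
      intro ω η
      rw [hx ω, hx η]
    refine (percolationExp_mono h0 h1 hl).trans ?_
    refine le_trans ?_ (percolationExp_mono h0 h1 fun ω => percolationExp_mono h0 h1 (hr ω))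
    simp only [percolationExp_const, le_refl]
  | succ n ih =>
    intro F hF
    let Fb : Bool → Bool → (Fin n → Bool) → (Fin n → Bool) → Prop :=
      fun b c x y => F (Fin.cons b x) (Fin.cons c y)
    have hFb : ∀ b c x x' y y', x ≤ x' → y ≤ y' → Fb b c x y → Fb b c x' y' :=
      fun b c x x' y y' hx hy => hF _ _ _ _ (cons_le_cons le_rfl hx) (cons_le_cons le_rfl hy)
    have hbool : ∀ b c b' c' x y, b ≤ b' → c ≤ c' → Fb b c x y → Fb b' c' x y :=
      fun b c b' c' x y hb hc => hF _ _ _ _ (cons_le_cons hb le_rfl) (cons_le_cons hc le_rfl)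
    have ihor := ih (fun x y => Fb true false x y ∨ Fb false true x y)
      (fun x x' y y' hx hy h => h.imp (hFb _ _ _ _ _ _ hx hy) (hFb _ _ _ _ _ _ hx hy))
    have ihff := ih (Fb false false) (hFb _ _)
    have htrue : ∀ η : Fin n → Bool,
        (∃ s, F ((Fin.cons true η : Fin (n + 1) → Bool) ⊓ s) (Fin.cons true η ⊓ sᶜ)) →
        ∃ s, Fb true false (η ⊓ s) (η ⊓ sᶜ) ∨ Fb false true (η ⊓ s) (η ⊓ sᶜ) := by
      rintro η ⟨s, hs⟩
      refine ⟨Fin.tail s, ?_⟩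
      rw [← Fin.cons_self_tail s, compl_cons, cons_inf_cons, cons_inf_cons] at hs
      cases h : s 0
      · right; rw [h] at hs; exact hs
      · left; rw [h] at hs; exact hs
    have hfalse : ∀ η : Fin n → Bool,
        (∃ s, F ((Fin.cons false η : Fin (n + 1) → Bool) ⊓ s) (Fin.cons false η ⊓ sᶜ)) →
        ∃ s, Fb false false (η ⊓ s) (η ⊓ sᶜ) := by
      rintro η ⟨s, hs⟩
      refine ⟨Fin.tail s, ?_⟩
      rw [← Fin.cons_self_tail s, compl_cons, cons_inf_cons, cons_inf_cons] at hs
      simpa using hs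
    have hp' : 0 ≤ 1 - p := sub_nonneg.2 h1
    rw [percolationExp_succ]
    calc _ ≤ p * percolationExp p (fun ω => percolationExp p (fun η =>
              propIndicator (Fb true false ω η ∨ Fb false true ω η))) +
            (1 - p) * percolationExp p (fun ω => percolationExp p (fun η =>
              propIndicator (Fb false false ω η))) := by
          refine add_le_add (mul_le_mul_of_nonneg_left (le_trans ?_ ihor) h0)
            (mul_le_mul_of_nonneg_left (le_trans ?_ ihff) hp')
          · exact percolationExp_mono h0 h1 fun η => propIndicator_mono (htrue η)
          · exact percolationExp_mono h0 h1 fun η => propIndicator_mono (hfalse η)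
      _ = percolationExp p (fun ω => percolationExp p (fun η =>
            p * propIndicator (Fb true false ω η ∨ Fb false true ω η) +
              (1 - p) * propIndicator (Fb false false ω η))) := by
          simp only [percolationExp_add, percolationExp_const_mul]
      _ ≤ percolationExp p (fun ω => percolationExp p (fun η =>
            p * (p * propIndicator (Fb true true ω η) +
              (1 - p) * propIndicator (Fb true false ω η)) +
            (1 - p) * (p * propIndicator (Fb false true ω η) +
              (1 - p) * propIndicator (Fb false false ω η)))) := by
          refine percolationExp_mono h0 h1 fun ω => percolationExp_mono h0 h1 fun η => ?_
          have e1 := hbool false false true false ω η (by simp) (by simp)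
          have e2 := hbool false false false true ω η (by simp) (by simp)
          have e3 := hbool true false true true ω η (by simp) (by simp)
          have e4 := hbool false true true true ω η (by simp) (by simp)
          generalize Fb true true ω η = A at *
          generalize Fb true false ω η = B at *
          generalize Fb false true ω η = C at *
          generalize Fb false false ω η = D at *
          clear ihor ihff htrue hfalse hFb hbool ih hF
          have hpp := mul_nonneg h0 hp'
          unfold propIndicator
          split_ifs <;> first | (exfalso; tauto) | nlinarith
      _ = _ := by
          rw [percolationExp_succ]
          simp only [percolationExp_succ (n := n), percolationExp_add, percolationExp_const_mul]
          rfl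

/-- The Efron–Stein inequality for Bernoulli site percolation. -/
theorem percolationExp_sq_le (h0 : 0 ≤ p) (h1 : p ≤ 1) :
    ∀ {n : ℕ} (f : (Fin n → Bool) → ℝ),
      percolationExp p (fun ω => f ω ^ 2) ≤ percolationExp p f ^ 2 +
        p * (1 - p) * ∑ v, percolationExp p (fun ω =>
          (f (Function.update ω v true) - f (Function.update ω v false)) ^ 2) := by
  intro n
  induction n with
  | zero =>
    intro f
    obtain ⟨c, rfl⟩ : ∃ c, f = fun _ => c :=
      ⟨f default, funext fun x => by rw [Subsingleton.elim x default]⟩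
    simp [percolationExp_const]
  | succ n ih =>
    intro f
    have hp' : 0 ≤ 1 - p := sub_nonneg.2 h1
    set a : (Fin n → Bool) → ℝ := fun η => f (Fin.cons true η) with ha
    set b : (Fin n → Bool) → ℝ := fun η => f (Fin.cons false η) with hb
    have hsq : percolationExp p (fun ω => f ω ^ 2) =
        percolationExp p (fun η => (p * a η + (1 - p) * b η) ^ 2) +
          p * (1 - p) * percolationExp p (fun η => (a η - b η) ^ 2) := by
      rw [percolationExp_succ]
      simp only [← percolationExp_const_mul, ← percolationExp_add]
      congr 1; ext η; ring
    have hE : percolationExp p f = percolationExp p (fun η => p * a η + (1 - p) * b η) := by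
      rw [percolationExp_succ]
      simp only [percolationExp_const_mul, percolationExp_add, ha, hb]
    have h := ih (fun η => p * a η + (1 - p) * b η)
    have hD : ∀ v : Fin n, percolationExp p (fun ω =>
          ((p * a (Function.update ω v true) + (1 - p) * b (Function.update ω v true)) -
            (p * a (Function.update ω v false) + (1 - p) * b (Function.update ω v false))) ^ 2) ≤
        percolationExp p (fun ω : Fin (n + 1) → Bool =>
          (f (Function.update ω v.succ true) - f (Function.update ω v.succ false)) ^ 2) := by
      intro v
      rw [percolationExp_succ, ← percolationExp_const_mul, ← percolationExp_const_mul,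
        ← percolationExp_add]
      refine percolationExp_mono h0 h1 fun ω => ?_
      simp only [← Fin.cons_update]
      change _ ≤ p * (a _ - a _) ^ 2 + (1 - p) * (b _ - b _) ^ 2
      nlinarith [mul_nonneg (mul_nonneg h0 hp') (sq_nonneg
        ((a (Function.update ω v true) - a (Function.update ω v false)) -
          (b (Function.update ω v true) - b (Function.update ω v false))))]
    have hD0 : percolationExp p (fun ω : Fin (n + 1) → Bool =>
          (f (Function.update ω 0 true) - f (Function.update ω 0 false)) ^ 2) =
        percolationExp p (fun η => (a η - b η) ^ 2) := by
      rw [percolationExp_succ]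
      simp only [Fin.update_cons_zero]
      ring
    rw [hsq, hE, Fin.sum_univ_succ, hD0]
    have := mul_le_mul_of_nonneg_left (sum_le_sum fun v (_ : v ∈ univ) => hD v)
      (mul_nonneg h0 hp')
    linarith

theorem percolationExp_chebyshev (h0 : 0 ≤ p) (h1 : p ≤ 1) {V : Type*} [Fintype V] [DecidableEq V]
    (f : (V → Bool) → ℝ) {t a σ : ℝ} (ht : 0 < t) (ha : percolationExp p f ≤ a)
    (hσ : percolationExp p (fun ω => f ω ^ 2) ≤ percolationExp p f ^ 2 + σ) :
    1 - σ / t ^ 2 ≤ percolationExp p (fun ω => propIndicator (f ω ≤ a + t)) := by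
  set m := percolationExp p f with hm
  have hvar : percolationExp p (fun ω => (f ω - m) ^ 2) ≤ σ := by
    have : percolationExp p (fun ω => (f ω - m) ^ 2) =
        percolationExp p (fun ω => f ω ^ 2) - 2 * m * m + m ^ 2 := by
      have e : ∀ ω, (f ω - m) ^ 2 = f ω ^ 2 - 2 * m * f ω + m ^ 2 := fun ω => by ring
      simp only [e, percolationExp_add, percolationExp_sub, percolationExp_const,
        percolationExp_const_mul, ← hm]
    rw [this]; nlinarith
  have hpt : ∀ ω, 1 - 1 / t ^ 2 * (f ω - m) ^ 2 ≤ propIndicator (f ω ≤ a + t) := by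
    intro ω
    by_cases h : f ω ≤ a + t
    · rw [propIndicator_of_true h]
      have : 0 ≤ 1 / t ^ 2 * (f ω - m) ^ 2 := by positivity
      linarith
    · rw [propIndicator_of_false h]
      push Not at h
      have : t ^ 2 ≤ (f ω - m) ^ 2 := by nlinarith
      have : 1 ≤ 1 / t ^ 2 * (f ω - m) ^ 2 := by
        rw [one_div, inv_mul_eq_div, le_div_iff₀ (by positivity)]; linarith
      linarith
  refine le_trans ?_ (percolationExp_mono h0 h1 hpt)
  rw [percolationExp_sub, percolationExp_const, percolationExp_const_mul, one_div,
    inv_mul_eq_div]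
  have := div_le_div_of_nonneg_right hvar (sq_nonneg t)
  linarith

end Fin

section Excess

variable {V : Type*} [Fintype V] [DecidableEq V]

/-- The number of edges plus the number of connected components of a graph. -/
noncomputable def edgesAddComponents (H : SimpleGraph V) : ℝ :=
  H.edgeSet.ncard + Nat.card H.ConnectedComponent

omit [Fintype V] [DecidableEq V] in
theorem reachable_of_reachable_sup_edge {H : SimpleGraph V} {x y a b : V}
    (h : (H ⊔ SimpleGraph.edge x y).Reachable a b) :
    H.Reachable a b ∨ (H.Reachable a x ∧ H.Reachable y b) ∨
      (H.Reachable a y ∧ H.Reachable x b) := by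
  obtain ⟨w⟩ := h
  induction w with
  | nil => exact Or.inl .rfl
  | cons hadj _ ih =>
    rw [SimpleGraph.sup_adj, SimpleGraph.edge_adj] at hadj
    rcases hadj with hadj | ⟨⟨rfl, rfl⟩ | ⟨rfl, rfl⟩, _⟩
    · have := hadj.reachable
      rcases ih with ih | ⟨ih, ih'⟩ | ⟨ih, ih'⟩
      · exact Or.inl (this.trans ih)
      · exact Or.inr (Or.inl ⟨this.trans ih, ih'⟩)
      · exact Or.inr (Or.inr ⟨this.trans ih, ih'⟩)
    · rcases ih with ih | ⟨ih, ih'⟩ | ⟨ih, ih'⟩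
      · exact Or.inr (Or.inl ⟨.rfl, ih⟩)
      · exact Or.inr (Or.inl ⟨.rfl, ih'⟩)
      · exact Or.inl ih'
    · rcases ih with ih | ⟨ih, ih'⟩ | ⟨ih, ih'⟩
      · exact Or.inr (Or.inr ⟨.rfl, ih⟩)
      · exact Or.inl ih'
      · exact Or.inr (Or.inr ⟨.rfl, ih'⟩)

omit [DecidableEq V] in
theorem ncard_edgeSet_sup_edge {H : SimpleGraph V} {x y : V} (hne : x ≠ y) (hadj : ¬H.Adj x y) :
    (H ⊔ SimpleGraph.edge x y).edgeSet.ncard = H.edgeSet.ncard + 1 := by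
  rw [SimpleGraph.edgeSet_sup, SimpleGraph.edgeSet_edge_of_ne hne, Set.union_singleton,
    Set.ncard_insert_of_notMem (by simpa using hadj) (Set.toFinite _)]

omit [Fintype V] [DecidableEq V] in
theorem surjective_component_map_of_le {H H' : SimpleGraph V} (h : H ≤ H') :
    Function.Surjective (SimpleGraph.ConnectedComponent.map (SimpleGraph.Hom.ofLE h)) := by
  intro C
  induction C using SimpleGraph.ConnectedComponent.ind with
  | h v => exact ⟨H.connectedComponentMk v, rfl⟩

omit [DecidableEq V] in
theorem card_component_sup_edge_le (H : SimpleGraph V) (x y : V) :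
    Nat.card (H ⊔ SimpleGraph.edge x y).ConnectedComponent ≤ Nat.card H.ConnectedComponent :=
  Nat.card_le_card_of_surjective _ (surjective_component_map_of_le le_sup_left)

omit [DecidableEq V] in
theorem card_component_sup_edge_lt {H : SimpleGraph V} {x y : V} (h : ¬H.Reachable x y) :
    Nat.card (H ⊔ SimpleGraph.edge x y).ConnectedComponent < Nat.card H.ConnectedComponent := by
  classical
  have hne : x ≠ y := fun hxy => h (hxy ▸ .rfl)
  rw [Nat.card_eq_fintype_card, Nat.card_eq_fintype_card]
  refine Fintype.card_lt_of_surjective_not_injective _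
    (surjective_component_map_of_le (H := H) le_sup_left) fun hinj => h ?_
  refine SimpleGraph.ConnectedComponent.exact (hinj ?_)
  refine SimpleGraph.ConnectedComponent.sound (SimpleGraph.Adj.reachable ?_)
  simp [SimpleGraph.edge_adj, hne]

omit [DecidableEq V] in
theorem card_component_le_sup_edge (H : SimpleGraph V) (x y : V) :
    Nat.card H.ConnectedComponent ≤
      Nat.card (H ⊔ SimpleGraph.edge x y).ConnectedComponent + 1 := by
  classical
  have key : Nat.card {C : H.ConnectedComponent // C ≠ H.connectedComponentMk x} ≤
      Nat.card (H ⊔ SimpleGraph.edge x y).ConnectedComponent := by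
    refine Nat.card_le_card_of_injective (fun C => SimpleGraph.ConnectedComponent.map
      (SimpleGraph.Hom.ofLE (le_sup_left : H ≤ H ⊔ SimpleGraph.edge x y)) C.1) ?_
    rintro ⟨C, hC⟩ ⟨D, hD⟩ hCD
    induction C using SimpleGraph.ConnectedComponent.ind with
    | h a =>
      induction D using SimpleGraph.ConnectedComponent.ind with
      | h b =>
        rcases reachable_of_reachable_sup_edge (SimpleGraph.ConnectedComponent.exact hCD) with
          h | ⟨h, _⟩ | ⟨_, h⟩
        · exact Subtype.ext (SimpleGraph.ConnectedComponent.sound h)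
        · exact absurd (SimpleGraph.ConnectedComponent.sound h) hC
        · exact absurd (SimpleGraph.ConnectedComponent.sound h.symm) hD
  rw [Nat.card_eq_fintype_card, Fintype.card_subtype_compl, Fintype.card_subtype_eq] at key
  rw [Nat.card_eq_fintype_card]
  omega

/-- The star with centre `v` and set of leaves `T`. -/
def starGraph (v : V) (T : Finset V) : SimpleGraph V where
  Adj a b := a ≠ b ∧ ((a = v ∧ b ∈ T) ∨ (b = v ∧ a ∈ T))
  symm := ⟨fun _ _ h => ⟨h.1.symm, h.2.symm⟩⟩
  loopless := ⟨fun _ h => h.1 rfl⟩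

omit [Fintype V] in
theorem sup_starGraph_insert (H : SimpleGraph V) (v u : V) (T : Finset V) :
    H ⊔ starGraph v (insert u T) = (H ⊔ starGraph v T) ⊔ SimpleGraph.edge v u := by
  ext a b
  simp only [SimpleGraph.sup_adj, starGraph, SimpleGraph.edge_adj, mem_insert]
  constructor
  · rintro (h | ⟨h, h' | h'⟩) <;> tauto
  · rintro ((h | ⟨h, h' | h'⟩) | ⟨h' | h', h⟩) <;> tauto

omit [Fintype V] [DecidableEq V] in
theorem exists_leaf_reachable {H : SimpleGraph V} {v : V} (hv : ∀ b, ¬H.Adj v b) (T : Finset V)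
    {x : V} (hx : x ≠ v) (h : (H ⊔ starGraph v T).Reachable x v) :
    ∃ w ∈ T, H.Reachable x w := by
  suffices ∀ {x y : V}, (H ⊔ starGraph v T).Walk x y → y = v → x ≠ v → ∃ w ∈ T, H.Reachable x w by
    obtain ⟨w⟩ := h
    exact this w rfl hx
  intro x y w hy hx
  induction w with
  | nil => exact absurd hy hx
  | @cons a b c hadj _ ih =>
    rw [SimpleGraph.sup_adj] at hadj
    rcases hadj with hadj | ⟨_, ⟨h, _⟩ | ⟨_, ha⟩⟩
    · obtain ⟨w, hw, hr⟩ := ih hy (fun hb => hv a (hb ▸ hadj.symm))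
      exact ⟨w, hw, hadj.reachable.trans hr⟩
    · exact absurd h hx
    · exact ⟨a, ha, .rfl⟩

/-- The effect of adding a star with centre at an isolated vertex. -/
theorem edgesAddComponents_sup_starGraph {H : SimpleGraph V} {v : V} (hv : ∀ b, ¬H.Adj v b)
    (T : Finset V) (hvT : v ∉ T) :
    edgesAddComponents H ≤ edgesAddComponents (H ⊔ starGraph v T) ∧
    edgesAddComponents (H ⊔ starGraph v T) ≤ edgesAddComponents H + #T ∧
    edgesAddComponents (H ⊔ starGraph v T) ≤ edgesAddComponents H +
      ∑ u ∈ T, ∑ w ∈ T, propIndicator (u ≠ w ∧ H.Reachable u w) := by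
  induction T using Finset.induction_on with
  | empty =>
    have : H ⊔ starGraph v ∅ = H := by
      ext a b; simp [starGraph]
    simp [this]
  | insert u T hu ih =>
    have huv : u ≠ v := fun h => hvT (h ▸ mem_insert_self _ _)
    have hvT' : v ∉ T := fun h => hvT (mem_insert_of_mem h)
    obtain ⟨ih1, ih2, ih3⟩ := ih hvT'
    rw [sup_starGraph_insert H v u T]
    set H' := H ⊔ starGraph v T with hH'
    have hnadj : ¬H'.Adj v u := by
      rw [hH', SimpleGraph.sup_adj]
      rintro (h | ⟨_, ⟨_, h⟩ | ⟨h, _⟩⟩)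
      · exact hv u h
      · exact hu h
      · exact huv h
    have hE := ncard_edgeSet_sup_edge huv.symm hnadj
    have hc1 := card_component_sup_edge_le H' v u
    have hc2 := card_component_le_sup_edge H' v u
    have hle : ∑ x ∈ T, ∑ w ∈ T, propIndicator (x ≠ w ∧ H.Reachable x w) +
        ∑ w ∈ T, propIndicator (u ≠ w ∧ H.Reachable u w) ≤
        ∑ x ∈ insert u T, ∑ w ∈ insert u T, propIndicator (x ≠ w ∧ H.Reachable x w) := by
      simp only [sum_insert hu, sum_add_distrib]
      have h1 := propIndicator_nonneg (u ≠ u ∧ H.Reachable u u)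
      have h2 := sum_nonneg fun x (_ : x ∈ T) => propIndicator_nonneg (x ≠ u ∧ H.Reachable x u)
      linarith
    have hnn : 0 ≤ ∑ w ∈ T, propIndicator (u ≠ w ∧ H.Reachable u w) :=
      sum_nonneg fun w _ => propIndicator_nonneg _
    rw [card_insert_of_notMem hu]
    unfold edgesAddComponents at *
    rw [hE]
    have hc1' : (Nat.card (H' ⊔ SimpleGraph.edge v u).ConnectedComponent : ℝ) ≤
      Nat.card H'.ConnectedComponent := by exact_mod_cast hc1
    have hc2' : (Nat.card H'.ConnectedComponent : ℝ) ≤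
      Nat.card (H' ⊔ SimpleGraph.edge v u).ConnectedComponent + 1 := by exact_mod_cast hc2
    push_cast
    refine ⟨by linarith, by linarith, ?_⟩
    by_cases hr : H'.Reachable v u
    · obtain ⟨w, hw, hrw⟩ := exists_leaf_reachable hv T huv hr.symm
      have huw : u ≠ w := fun h => hu (h ▸ hw)
      have : 1 ≤ ∑ w ∈ T, propIndicator (u ≠ w ∧ H.Reachable u w) := by
        rw [← propIndicator_of_true (P := u ≠ w ∧ H.Reachable u w) ⟨huw, hrw⟩]
        exact single_le_sum (f := fun w => propIndicator (u ≠ w ∧ H.Reachable u w))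
          (fun w _ => propIndicator_nonneg _) hw
      linarith
    · have hc3 := card_component_sup_edge_lt hr
      have hc3' : (Nat.card (H' ⊔ SimpleGraph.edge v u).ConnectedComponent : ℝ) + 1 ≤
        Nat.card H'.ConnectedComponent := by exact_mod_cast hc3
      linarith

/-- The spanning subgraph of `G` formed by the edges with both ends open in `ω`. -/
def openGraph (G : SimpleGraph V) (ω : V → Bool) : SimpleGraph V where
  Adj a b := G.Adj a b ∧ ω a = true ∧ ω b = true
  symm := ⟨fun _ _ h => ⟨h.1.symm, h.2.2, h.2.1⟩⟩
  loopless := ⟨fun _ h => G.loopless.irrefl _ h.1⟩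

open Classical in
/-- The open neighbours of `v`. -/
noncomputable def openNeighbors (G : SimpleGraph V) (ω : V → Bool) (v : V) : Finset V :=
  univ.filter fun u => G.Adj v u ∧ ω u = true

theorem openGraph_update_true (G : SimpleGraph V) (ω : V → Bool) (v : V) :
    openGraph G (Function.update ω v true) =
      openGraph G (Function.update ω v false) ⊔ starGraph v (openNeighbors G ω v) := by
  ext a b
  simp only [SimpleGraph.sup_adj, openGraph, starGraph, openNeighbors, mem_filter, mem_univ,
    true_and, Function.update_apply]
  by_cases ha : a = v
  · subst ha
    by_cases hb : b = a
    · subst hb; simp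
    · have : a ≠ b := Ne.symm hb
      simp [hb, this]
  · by_cases hb : b = v
    · subst hb; simp [ha, G.adj_comm]
    · simp [ha, hb]

/-- Opening a vertex changes the excess by at most its number of open neighbours, and by at most
the number of pairs of open neighbours that were connected before. -/
theorem edgesAddComponents_update (G : SimpleGraph V) (ω : V → Bool) (v : V) :
    edgesAddComponents (openGraph G (Function.update ω v false)) ≤
      edgesAddComponents (openGraph G (Function.update ω v true)) ∧
    edgesAddComponents (openGraph G (Function.update ω v true)) ≤
      edgesAddComponents (openGraph G (Function.update ω v false)) + #(openNeighbors G ω v) ∧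
    edgesAddComponents (openGraph G (Function.update ω v true)) ≤
      edgesAddComponents (openGraph G (Function.update ω v false)) +
        ∑ u ∈ openNeighbors G ω v, ∑ w ∈ openNeighbors G ω v,
          propIndicator (u ≠ w ∧ (openGraph G (Function.update ω v false)).Reachable u w) := by
  rw [openGraph_update_true]
  refine edgesAddComponents_sup_starGraph (fun b h => ?_) _ (by simp [openNeighbors])
  simpa using h.2.1

omit [DecidableEq V] in
theorem edgesAddComponents_openGraph_false_le (G : SimpleGraph V) :
    edgesAddComponents (openGraph G fun _ => false) ≤ Fintype.card V := by
  have : openGraph G (fun _ => false) = ⊥ := by ext a b; simp [openGraph]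
  rw [this, edgesAddComponents, SimpleGraph.edgeSet_bot, Set.ncard_empty, Nat.cast_zero, zero_add,
    ← Nat.card_eq_fintype_card]
  exact_mod_cast Nat.card_le_card_of_surjective (⊥ : SimpleGraph V).connectedComponentMk
    fun C => C.ind fun v => ⟨v, rfl⟩

omit [DecidableEq V] in
/-- The percolated subgraph as an induced subgraph versus as a spanning subgraph. -/
theorem excess_induce_le (G : SimpleGraph V) (ω : V → Bool) :
    ((G.induce (percSet ω)).edgeSet.ncard : ℝ) - (percSet ω).ncard +
        Nat.card (G.induce (percSet ω)).ConnectedComponent ≤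
      edgesAddComponents (openGraph G ω) - Fintype.card V := by
  classical
  have hE : (G.induce (percSet ω)).edgeSet.ncard ≤ (openGraph G ω).edgeSet.ncard := by
    refine Set.ncard_le_ncard_of_injOn (Sym2.map Subtype.val) ?_
      (Sym2.map.injective Subtype.val_injective).injOn (Set.toFinite _)
    intro e he
    induction e using Sym2.ind with
    | _ a b => exact ⟨he, a.2, b.2⟩
  have hreach : ∀ {a b : V}, (openGraph G ω).Reachable a b →
      a = b ∨ ∃ (ha : a ∈ percSet ω) (hb : b ∈ percSet ω),
        (G.induce (percSet ω)).Reachable ⟨a, ha⟩ ⟨b, hb⟩ := by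
    rintro a b ⟨w⟩
    induction w with
    | nil => exact Or.inl rfl
    | @cons a b c hadj _ ih =>
      have h1 : (G.induce (percSet ω)).Reachable ⟨a, hadj.2.1⟩ ⟨b, hadj.2.2⟩ :=
        SimpleGraph.Adj.reachable (by exact hadj.1)
      rcases ih with rfl | ⟨hb, hc, h⟩
      · exact Or.inr ⟨hadj.2.1, hadj.2.2, h1⟩
      · exact Or.inr ⟨hadj.2.1, hc, h1.trans h⟩
  have hC : Nat.card ((G.induce (percSet ω)).ConnectedComponent ⊕ ↥(percSet ω)ᶜ) ≤
      Nat.card (openGraph G ω).ConnectedComponent := by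
    let φ : G.induce (percSet ω) →g openGraph G ω :=
      ⟨Subtype.val, fun {a b} h => ⟨h, a.2, b.2⟩⟩
    refine Nat.card_le_card_of_injective
      (Sum.elim (SimpleGraph.ConnectedComponent.map φ)
        fun v => (openGraph G ω).connectedComponentMk v.1) ?_
    rintro (C | a) (D | b) h
    · induction C using SimpleGraph.ConnectedComponent.ind with
      | h a =>
        induction D using SimpleGraph.ConnectedComponent.ind with
        | h b =>
          rcases hreach (SimpleGraph.ConnectedComponent.exact h) with h | ⟨_, _, h⟩
          · rw [Subtype.ext h]
          · exact congrArg _ (SimpleGraph.ConnectedComponent.sound h)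
    · induction C using SimpleGraph.ConnectedComponent.ind with
      | h a =>
        rcases hreach (SimpleGraph.ConnectedComponent.exact h) with h | ⟨_, hb, _⟩
        · exact absurd (by rw [← h]; exact a.2) b.2
        · exact absurd hb b.2
    · induction D using SimpleGraph.ConnectedComponent.ind with
      | h b =>
        rcases hreach (SimpleGraph.ConnectedComponent.exact h) with h | ⟨ha, _, _⟩
        · exact absurd (by rw [h]; exact b.2) a.2
        · exact absurd ha a.2
    · rcases hreach (SimpleGraph.ConnectedComponent.exact h) with h | ⟨ha, _, _⟩
      · rw [Subtype.ext h]
      · exact absurd ha a.2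
  have hcompl := Set.ncard_add_ncard_compl (percSet ω)
  rw [Nat.card_sum, Nat.card_coe_set_eq] at hC
  rw [Nat.card_eq_fintype_card] at hcompl
  have hE' : ((G.induce (percSet ω)).edgeSet.ncard : ℝ) ≤ (openGraph G ω).edgeSet.ncard := by
    exact_mod_cast hE
  have hC' : (Nat.card (G.induce (percSet ω)).ConnectedComponent : ℝ) +
      ((percSet ω)ᶜ).ncard ≤ Nat.card (openGraph G ω).ConnectedComponent := by exact_mod_cast hC
  have hcompl' : ((percSet ω).ncard : ℝ) + ((percSet ω)ᶜ).ncard = Fintype.card V := by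
    exact_mod_cast hcompl
  unfold edgesAddComponents
  linarith

end Excess

section Paths

variable {V : Type*} [Fintype V] [DecidableEq V] {p : ℝ}

/-- There is a path with `k` steps in `G` that starts at `u`, avoids `A`, ends in `T`, and all of
whose vertices, except perhaps `u`, are open. -/
def HasOpenPath (G : SimpleGraph V) (T : V → Prop) :
    ℕ → Finset V → V → (V → Bool) → Prop
  | 0, _, u, _ => T u
  | k + 1, A, u, ω =>
    ∃ w, (G.Adj u w ∧ w ∉ insert u A) ∧ ω w = true ∧ HasOpenPath G T k (insert u A) w ω

omit [Fintype V] in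
theorem HasOpenPath.mono {G : SimpleGraph V} {T : V → Prop} :
    ∀ {k : ℕ} {A : Finset V} {u : V} {ω ω' : V → Bool}, ω ≤ ω' →
      HasOpenPath G T k A u ω → HasOpenPath G T k A u ω'
  | 0, _, _, _, _, _, h => h
  | _ + 1, _, _, _, _, hle, ⟨w, hw, ho, h⟩ => ⟨w, hw, hle w ho, h.mono hle⟩

omit [Fintype V] in
theorem hasOpenPath_update {G : SimpleGraph V} {T : V → Prop} :
    ∀ {k : ℕ} {A : Finset V} {u v : V} (ω : V → Bool) (b : Bool), v ∈ insert u A →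
      (HasOpenPath G T k A u (Function.update ω v b) ↔ HasOpenPath G T k A u ω) := by
  intro k
  induction k with
  | zero => intros; rfl
  | succ k ih =>
    intro A u v ω b hv
    refine exists_congr fun w => and_congr_right fun hw => ?_
    have hne : w ≠ v := fun h => hw.2 (h ▸ hv)
    rw [Function.update_of_ne hne, ih ω b (mem_insert_of_mem hv)]

omit [Fintype V] in
theorem hasOpenPath_of_sequence {G : SimpleGraph V} {T : V → Prop} {ω : V → Bool} :
    ∀ {k : ℕ} {A : Finset V} (f : ℕ → V), (∀ j < k, G.Adj (f j) (f (j + 1))) →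
      (∀ j, 1 ≤ j → j ≤ k → f j ∉ A) → Set.InjOn f (Set.Iic k) →
      (∀ j, 1 ≤ j → j ≤ k → ω (f j) = true) → T (f k) → HasOpenPath G T k A (f 0) ω := by
  intro k
  induction k with
  | zero => intro A f _ _ _ _ h; exact h
  | succ k ih =>
    intro A f hadj hA hinj ho hT
    have hn : ∀ j, 1 ≤ j → j ≤ k + 1 → f j ≠ f 0 := fun j h1 h2 h => by
      have := hinj (Set.mem_Iic.2 h2) (Set.mem_Iic.2 (Nat.zero_le _)) h
      omega
    refine ⟨f 1, ⟨hadj 0 k.succ_pos, ?_⟩, ho 1 le_rfl (by omega), ?_⟩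
    · rw [mem_insert, not_or]
      exact ⟨hn 1 le_rfl (by omega), hA 1 le_rfl (by omega)⟩
    · refine ih (fun j => f (j + 1)) (fun j hj => hadj _ (by omega)) (fun j h1 h2 => ?_)
        (fun i hi j hj h => ?_) (fun j h1 h2 => ho _ (by omega) (by omega)) hT
      · rw [mem_insert, not_or]
        exact ⟨hn _ (by omega) (by omega), hA _ (by omega) (by omega)⟩
      · have := hinj (Set.mem_Iic.2 (by simpa using hi)) (Set.mem_Iic.2 (by simpa using hj)) h
        omega

theorem percolationExp_open_hasOpenPath (G : SimpleGraph V) (T : V → Prop) (k : ℕ) (A : Finset V)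
    (u : V) :
    percolationExp p (fun ω => propIndicator (ω u = true ∧ HasOpenPath G T k A u ω)) =
      p * percolationExp p (fun ω => propIndicator (HasOpenPath G T k A u ω)) := by
  simp only [propIndicator_and]
  exact percolationExp_open_mul u _ fun ω b => by
    rw [hasOpenPath_update ω b (mem_insert_self _ _)]

theorem propIndicator_exists_le {ι : Type*} (s : Finset ι) (P : ι → Prop) :
    propIndicator (∃ i ∈ s, P i) ≤ ∑ i ∈ s, propIndicator (P i) := by
  by_cases h : ∃ i ∈ s, P i
  · obtain ⟨i, hi, hP⟩ := h
    calc propIndicator (∃ i ∈ s, P i) ≤ 1 := propIndicator_le_one _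
      _ = propIndicator (P i) := (propIndicator_of_true hP).symm
      _ ≤ _ := single_le_sum (f := fun i => propIndicator (P i))
        (fun _ _ => propIndicator_nonneg _) hi
  · rw [propIndicator_of_false h]
    exact sum_nonneg fun _ _ => propIndicator_nonneg _

/-- The expected number of open paths is bounded by the number of walks. -/
theorem percolationExp_hasOpenPath_le_pow (h0 : 0 ≤ p) (h1 : p ≤ 1) (G : SimpleGraph V)
    [DecidableRel G.Adj] (w : V) : ∀ (k : ℕ) (A : Finset V) (u : V),
      percolationExp p (fun ω => propIndicator (HasOpenPath G (· = w) k A u ω)) ≤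
        p ^ k * (G.adjMatrix ℝ ^ k) u w := by
  intro k
  induction k with
  | zero =>
    intro A u
    simp only [HasOpenPath, percolationExp_const, pow_zero, one_mul]
    by_cases h : u = w <;> simp [propIndicator, Matrix.one_apply, h]
  | succ k ih =>
    intro A u
    have hle : ∀ ω, propIndicator (HasOpenPath G (· = w) (k + 1) A u ω) ≤
        ∑ x ∈ G.neighborFinset u,
          propIndicator (ω x = true ∧ HasOpenPath G (· = w) k (insert u A) x ω) := fun ω =>
      (propIndicator_mono fun ⟨x, hx, h⟩ => ⟨x, by simpa using hx.1, h⟩).trans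
        (propIndicator_exists_le _ _)
    refine (percolationExp_mono h0 h1 hle).trans ?_
    rw [percolationExp_sum, pow_succ' (G.adjMatrix ℝ), SimpleGraph.adjMatrix_mul_apply, mul_sum]
    refine sum_le_sum fun x _ => ?_
    rw [percolationExp_open_hasOpenPath, pow_succ', mul_assoc]
    exact mul_le_mul_of_nonneg_left (ih _ _) h0

/-- An upper bound for the probability that a path of length `k` exists. -/
noncomputable def survivalBound (d : ℕ) (p : ℝ) : ℕ → ℝ
  | 0 => 1
  | k + 1 => 1 - (1 - p * survivalBound d p k) ^ d

theorem survivalBound_mem (d : ℕ) (h0 : 0 ≤ p) (h1 : p ≤ 1) (k : ℕ) :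
    0 ≤ survivalBound d p k ∧ survivalBound d p k ≤ 1 := by
  induction k with
  | zero => simp [survivalBound]
  | succ k ih =>
    have hx : 0 ≤ p * survivalBound d p k := mul_nonneg h0 ih.1
    have hx1 : p * survivalBound d p k ≤ 1 := mul_le_one₀ h1 ih.1 ih.2
    refine ⟨sub_nonneg.2 (pow_le_one₀ (by linarith) (by linarith)), ?_⟩
    exact sub_le_self _ (pow_nonneg (by linarith) _)

theorem percolationExp_hasOpenPath_le_survivalBound (h0 : 0 ≤ p) (h1 : p ≤ 1) (G : SimpleGraph V)
    [DecidableRel G.Adj] {d : ℕ} (hG : G.IsRegularOfDegree d) (T : V → Prop) :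
    ∀ (k : ℕ) (A : Finset V) (u : V),
      percolationExp p (fun ω => propIndicator (HasOpenPath G T k A u ω)) ≤
        survivalBound d p k := by
  intro k
  induction k with
  | zero =>
    intro A u
    exact (percolationExp_mono h0 h1 fun ω => propIndicator_le_one _).trans_eq
      (percolationExp_const 1)
  | succ k ih =>
    intro A u
    set B := (G.neighborFinset u).filter (· ∉ insert u A) with hB
    have hcard : #B ≤ d := (card_filter_le _ _).trans_eq (hG u)
    set f : V → (V → Bool) → ℝ := fun x ω =>
      propIndicator (ω x = true ∧ HasOpenPath G T k (insert u A) x ω) with hf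
    have hprod : ∀ ω, ∏ x ∈ B, (1 - f x ω) ≤
        1 - propIndicator (HasOpenPath G T (k + 1) A u ω) := by
      intro ω
      by_cases h : HasOpenPath G T (k + 1) A u ω
      · obtain ⟨x, hx, hx'⟩ := id h
        rw [propIndicator_of_true h, sub_self]
        refine le_of_eq (prod_eq_zero (i := x) (by simpa [hB] using hx) ?_)
        simp only [hf]
        rw [propIndicator_of_true hx', sub_self]
      · rw [propIndicator_of_false h, sub_zero]
        exact prod_le_one (fun x _ => sub_nonneg.2 (propIndicator_le_one _))
          fun x _ => sub_le_self _ (propIndicator_nonneg _)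
    have hharris := prod_one_sub_percolationExp_le h0 h1 B f (fun _ _ => propIndicator_nonneg _)
      (fun _ _ => propIndicator_le_one _)
      fun x ω ω' hle => propIndicator_mono fun h => ⟨hle x h.1, h.2.mono hle⟩
    have hmain := hharris.trans (percolationExp_mono h0 h1 hprod)
    rw [percolationExp_sub, percolationExp_const] at hmain
    obtain ⟨hs0, hs1⟩ := survivalBound_mem d h0 h1 k
    have hx0 : 0 ≤ 1 - p * survivalBound d p k := sub_nonneg.2 (mul_le_one₀ h1 hs0 hs1)
    have hlow : (1 - p * survivalBound d p k) ^ d ≤ ∏ x ∈ B, (1 - percolationExp p (f x)) :=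
      calc (1 - p * survivalBound d p k) ^ d ≤ (1 - p * survivalBound d p k) ^ #B :=
            pow_le_pow_of_le_one hx0 (sub_le_self _ (mul_nonneg h0 hs0)) hcard
        _ = ∏ x ∈ B, (1 - p * survivalBound d p k) := (prod_const _).symm
        _ ≤ _ := prod_le_prod (fun _ _ => hx0) fun x _ => by
            simp only [hf]
            rw [percolationExp_open_hasOpenPath]
            exact sub_le_sub_left (mul_le_mul_of_nonneg_left (ih _ _) h0) _
    rw [survivalBound]
    linarith

end Paths

theorem one_sub_pow_ge {x : ℝ} (h0 : 0 ≤ x) (h1 : x ≤ 1) (d : ℕ) :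
    1 - d * x + d * (d - 1) / 2 * x ^ 2 - d * (d - 1) * (d - 2) / 6 * x ^ 3 ≤ (1 - x) ^ d := by
  induction d with
  | zero => simp
  | succ d ih =>
    have h := mul_le_mul_of_nonneg_right ih (sub_nonneg.2 h1)
    rw [← pow_succ] at h
    refine le_trans ?_ h
    have hc : (0 : ℝ) ≤ d * (d - 1) * (d - 2) := by
      rcases d with _ | _ | d
      · simp
      · simp
      · push_cast
        have : (0 : ℝ) ≤ d := d.cast_nonneg
        have e : ((d : ℝ) + 1 + 1) * (d + 1 + 1 - 1) * (d + 1 + 1 - 2) =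
          (d + 2) * (d + 1) * d := by ring
        rw [e]; positivity
    have h4 := mul_nonneg hc (pow_nonneg h0 4)
    push_cast
    nlinarith

theorem one_sub_one_sub_pow_le {x : ℝ} (h0 : 0 ≤ x) (h1 : x ≤ 1) {d : ℕ} (hd : 2 ≤ d)
    (hdx : d * x ≤ 3 / 2) : 1 - (1 - x) ^ d ≤ d * x - (d * x) ^ 2 / 8 := by
  have h := one_sub_pow_ge h0 h1 d
  have hd' : (2 : ℝ) ≤ d := by exact_mod_cast hd
  have h3 : (0 : ℝ) ≤ 1 / 2 - (d - 2) * x / 3 := by nlinarith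
  have h4 : (0 : ℝ) ≤ d * (d - 1) / 2 * x ^ 2 * (1 / 2 - (d - 2) * x / 3) :=
    mul_nonneg (mul_nonneg (by nlinarith) (sq_nonneg _)) h3
  have h5 : (0 : ℝ) ≤ d * (d - 2) * x ^ 2 := mul_nonneg (by nlinarith) (sq_nonneg _)
  nlinarith

theorem survivalBound_succ_le {d : ℕ} (hd : 2 ≤ d) {p : ℝ} (h0 : 0 ≤ p) (h1 : p ≤ 1)
    (hdp : d * p ≤ 3 / 2) (k : ℕ) :
    survivalBound d p (k + 1) ≤
      d * p * survivalBound d p k - (d * p * survivalBound d p k) ^ 2 / 8 := by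
  obtain ⟨hs0, hs1⟩ := survivalBound_mem d h0 h1 k
  rw [survivalBound, mul_assoc]
  refine one_sub_one_sub_pow_le (mul_nonneg h0 hs0) (mul_le_one₀ h1 hs0 hs1) hd ?_
  rw [← mul_assoc]
  exact (mul_le_of_le_one_right (by positivity) hs1).trans hdp

theorem survivalBound_le {d : ℕ} (hd : 2 ≤ d) {p a : ℝ} (h0 : 0 ≤ p) (h1 : p ≤ 1)
    (hdp : d * p ≤ 3 / 2) (ha : 1 ≤ a) (hda : d * p ≤ a) (k : ℕ) :
    survivalBound d p k ≤ a ^ k * (8 / (k + 1)) := by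
  induction k with
  | zero => simp [survivalBound]
  | succ k ih =>
    refine (survivalBound_succ_le hd h0 h1 hdp k).trans ?_
    have hq : 1 ≤ a ^ (k + 1) := one_le_pow₀ ha
    have hq0 : 0 < a ^ (k + 1) := by linarith
    set t := d * p * survivalBound d p k / a ^ (k + 1) with ht
    have hx : d * p * survivalBound d p k = a ^ (k + 1) * t := by
      rw [ht]; field_simp
    have ht0 : 0 ≤ t :=
      div_nonneg (mul_nonneg (by positivity) (survivalBound_mem d h0 h1 k).1) hq0.le
    have htk : t ≤ 8 / (k + 1) := by
      rw [ht, div_le_iff₀ hq0, pow_succ']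
      calc d * p * survivalBound d p k ≤ a * (a ^ k * (8 / (k + 1))) :=
            mul_le_mul hda ih (survivalBound_mem d h0 h1 k).1 (by linarith)
        _ = _ := by ring
    rw [hx]
    have hk : (0 : ℝ) < k + 1 := by positivity
    have hkey : t - t ^ 2 / 8 ≤ 8 / (k + 1 + 1) := by
      rw [le_div_iff₀ (by positivity)]
      rw [le_div_iff₀ hk] at htk
      by_cases hc : t * (k + 1 + 1) ≤ 8
      · nlinarith [mul_nonneg (sq_nonneg t) hk.le]
      · push Not at hc
        nlinarith
    calc a ^ (k + 1) * t - (a ^ (k + 1) * t) ^ 2 / 8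
        ≤ a ^ (k + 1) * t - a ^ (k + 1) * t ^ 2 / 8 := by
          have : a ^ (k + 1) * t ^ 2 ≤ a ^ (k + 1) * a ^ (k + 1) * t ^ 2 := by
            nlinarith [mul_nonneg (mul_nonneg hq0.le (sq_nonneg t)) (sub_nonneg.2 hq)]
          nlinarith
      _ = a ^ (k + 1) * (t - t ^ 2 / 8) := by ring
      _ ≤ _ := by
          push_cast
          exact mul_le_mul_of_nonneg_left hkey hq0.le

theorem survivalBound_add_le {d : ℕ} (hd : 2 ≤ d) {p : ℝ} (h0 : 0 ≤ p) (h1 : p ≤ 1)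
    (hdp : d * p ≤ 3 / 2) (k m : ℕ) :
    survivalBound d p (k + m) ≤ (d * p) ^ m * survivalBound d p k := by
  induction m with
  | zero => simp
  | succ m ih =>
    refine (survivalBound_succ_le hd h0 h1 hdp (k + m)).trans ?_
    have h2 := mul_le_mul_of_nonneg_left ih (by positivity : 0 ≤ d * p)
    rw [pow_succ' (d * p) m, mul_assoc]
    linarith [sq_nonneg (d * p * survivalBound d p (k + m))]

section Connections

variable {V : Type*} [Fintype V] [DecidableEq V]

omit [Fintype V] in
/-- Two vertices connected by open vertices are joined by a short path or start disjoint long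
paths. -/
theorem hasOpenPath_or_disjoint_of_reachable (G : SimpleGraph V) (ω : V → Bool) {v u w : V}
    (M : ℕ) (hne : u ≠ w) (h : (openGraph G (Function.update ω v false)).Reachable u w) :
    (∃ L ∈ range (2 * M), ω u = true ∧ HasOpenPath G (· = w) (L + 1) {v} u ω) ∨
      ∃ s : V → Bool,
        ((ω ⊓ s) u = true ∧ HasOpenPath G (fun _ => True) M {v} u (ω ⊓ s)) ∧
          ((ω ⊓ sᶜ) w = true ∧ HasOpenPath G (fun _ => True) M {v} w (ω ⊓ sᶜ)) := by
  obtain ⟨q, hq⟩ := h.exists_isPath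
  have hlen : 1 ≤ q.length := by
    by_contra hc
    exact hne (SimpleGraph.Walk.eq_of_length_eq_zero (p := q) (by omega))
  have hinj := hq.getVert_injOn
  have hadj : ∀ j < q.length, (openGraph G (Function.update ω v false)).Adj (q.getVert j)
    (q.getVert (j + 1)) := fun j hj => q.adj_getVert_succ hj
  have hopen' : ∀ j ≤ q.length, Function.update ω v false (q.getVert j) = true := by
    intro j hj
    rcases hj.lt_or_eq with hj | hj
    · exact (hadj j hj).2.1
    · have := (hadj (j - 1) (by omega)).2.2
      rwa [Nat.sub_add_cancel (by omega)] at this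
  have hv : ∀ j ≤ q.length, q.getVert j ∉ ({v} : Finset V) := by
    intro j hj hjv
    have := hopen' j hj
    rw [mem_singleton.1 hjv, Function.update_self] at this
    exact Bool.false_ne_true this
  have hopen : ∀ j ≤ q.length, ω (q.getVert j) = true := by
    intro j hj
    have := hopen' j hj
    rwa [Function.update_of_ne fun h => hv j hj (mem_singleton.2 h)] at this
  rcases Nat.lt_or_ge (2 * M) q.length with hL | hL
  · right
    classical
    set s : V → Bool := fun z => decide (∃ j ≤ M, q.getVert j = z) with hs
    have h1 : ∀ j ≤ M, (ω ⊓ s) (q.getVert j) = true := by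
      intro j hj
      have : s (q.getVert j) = true := decide_eq_true ⟨j, hj, rfl⟩
      simp [this, hopen j (by omega)]
    have h2 : ∀ j ≤ M, (ω ⊓ sᶜ) (q.getVert (q.length - j)) = true := by
      intro j hj
      have : s (q.getVert (q.length - j)) = false := by
        refine decide_eq_false ?_
        rintro ⟨i, hi, hij⟩
        have := hinj (show i ≤ q.length by omega) (show q.length - j ≤ q.length by omega) hij
        omega
      simp [this, hopen (q.length - j) (by omega)]
    refine ⟨s, ⟨?_, ?_⟩, ?_, ?_⟩
    · simpa only [q.getVert_zero] using h1 0 (Nat.zero_le _)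
    · have := hasOpenPath_of_sequence (G := G) (T := fun _ => True) (ω := ω ⊓ s) (k := M) (A := {v})
        q.getVert (fun j hj => (hadj j (by omega)).1) (fun j _ hj => hv j (by omega))
        (hinj.mono fun j hj => show j ≤ q.length by have := Set.mem_Iic.1 hj; omega)
        (fun j _ hj => h1 j hj) trivial
      rwa [q.getVert_zero] at this
    · simpa only [Nat.sub_zero, q.getVert_length] using h2 0 (Nat.zero_le _)
    · have := hasOpenPath_of_sequence (G := G) (T := fun _ => True) (ω := ω ⊓ sᶜ) (k := M)
        (A := {v}) (fun j => q.getVert (q.length - j)) (fun j hj => by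
          have := (hadj (q.length - (j + 1)) (by omega)).1.symm
          rwa [show q.length - (j + 1) + 1 = q.length - j by omega] at this)
        (fun j _ hj => hv _ (by omega))
        (fun i hi j hj hij => by
          have hi := Set.mem_Iic.1 hi
          have hj := Set.mem_Iic.1 hj
          have := hinj (show q.length - i ≤ q.length by omega)
            (show q.length - j ≤ q.length by omega) hij
          omega)
        (fun j _ hj => h2 j hj) trivial
      simpa only [Nat.sub_zero, q.getVert_length] using this
  · left
    refine ⟨q.length - 1, mem_range.2 (by omega), ?_, ?_⟩
    · simpa only [q.getVert_zero] using hopen 0 (Nat.zero_le _)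
    · rw [Nat.sub_add_cancel hlen]
      have := hasOpenPath_of_sequence (G := G) (T := (· = w)) (ω := ω) (k := q.length)
        (A := {v}) q.getVert (fun j hj => (hadj j hj).1) (fun j _ hj => hv j hj)
        (hinj.mono fun j hj => Set.mem_Iic.1 hj)
        (fun j _ hj => hopen j hj) q.getVert_length
      rwa [q.getVert_zero] at this

theorem percolationExp_connected_le {n d : ℕ} (G : SimpleGraph (Fin n)) [DecidableRel G.Adj]
    (hG : G.IsRegularOfDegree d) {p : ℝ} (h0 : 0 ≤ p) (h1 : p ≤ 1) (v u w : Fin n) (M : ℕ) :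
    percolationExp p (fun ω => propIndicator ((ω u = true ∧ ω w = true) ∧
        u ≠ w ∧ (openGraph G (Function.update ω v false)).Reachable u w)) ≤
      ∑ L ∈ range (2 * M), p ^ (L + 2) * (G.adjMatrix ℝ ^ (L + 1)) u w +
        (p * survivalBound d p M) ^ 2 := by
  set F : (Fin n → Bool) → (Fin n → Bool) → Prop := fun x y =>
    (x u = true ∧ HasOpenPath G (fun _ => True) M {v} u x) ∧
      (y w = true ∧ HasOpenPath G (fun _ => True) M {v} w y) with hF
  have hle : ∀ ω, propIndicator ((ω u = true ∧ ω w = true) ∧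
        u ≠ w ∧ (openGraph G (Function.update ω v false)).Reachable u w) ≤
      ∑ L ∈ range (2 * M), propIndicator (ω u = true ∧ HasOpenPath G (· = w) (L + 1) {v} u ω) +
        propIndicator (∃ s, F (ω ⊓ s) (ω ⊓ sᶜ)) := fun ω =>
    ((propIndicator_mono fun h =>
      hasOpenPath_or_disjoint_of_reachable G ω M h.2.1 h.2.2).trans (propIndicator_or_le _ _)).trans
      (add_le_add_left (propIndicator_exists_le _ _) _)
  refine (percolationExp_mono h0 h1 hle).trans ?_
  rw [percolationExp_add, percolationExp_sum]
  refine add_le_add (sum_le_sum fun L _ => ?_) ?_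
  · rw [percolationExp_open_hasOpenPath, pow_succ' p (L + 1), mul_assoc]
    exact mul_le_mul_of_nonneg_left (percolationExp_hasOpenPath_le_pow h0 h1 G w _ _ _) h0
  · refine (percolationExp_disjoint_le h0 h1 F fun x x' y y' hx hy h => ?_).trans ?_
    · exact ⟨⟨hx u h.1.1, h.1.2.mono hx⟩, hy w h.2.1, h.2.2.mono hy⟩
    · have hb : ∀ z : Fin n, percolationExp p (fun ω => propIndicator
          (ω z = true ∧ HasOpenPath G (fun _ => True) M {v} z ω)) ≤ p * survivalBound d p M := by
        intro z
        rw [percolationExp_open_hasOpenPath]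
        exact mul_le_mul_of_nonneg_left
          (percolationExp_hasOpenPath_le_survivalBound h0 h1 G hG _ _ _ _) h0
      simp only [hF, propIndicator_and (_ ∧ _) (_ ∧ _), percolationExp_const_mul]
      simp only [mul_comm (propIndicator _) (percolationExp p _), percolationExp_const_mul]
      rw [sq]
      exact mul_le_mul (hb w) (hb u) (percolationExp_nonneg h0 h1 fun _ => propIndicator_nonneg _)
        (mul_nonneg h0 (survivalBound_mem d h0 h1 M).1)

end Connections

theorem Matrix.IsHermitian.trace_pow_eq_sum {n : Type*} [Fintype n] [DecidableEq n]
    {A : Matrix n n ℝ} (hA : A.IsHermitian) (k : ℕ) :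
    (A ^ k).trace = ∑ i, hA.eigenvalues i ^ k := by
  conv_lhs => rw [hA.spectral_theorem, ← map_pow, Matrix.diagonal_pow,
    Unitary.conjStarAlgAut_apply, Matrix.trace_mul_cycle, Unitary.coe_star_mul_self, one_mul,
    Matrix.trace_diagonal]
  simp

theorem IsNDLGraph.lam_nonneg {n d : ℕ} {lam : ℝ} {G : SimpleGraph (Fin n)}
    (hG : IsNDLGraph n d lam G) (hn : 2 ≤ n) : 0 ≤ lam := by
  obtain ⟨-, i₀, -, h⟩ := hG
  have : Nontrivial (Fin n) := Fin.nontrivial_iff_two_le.2 hn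
  obtain ⟨i, hi⟩ := exists_ne i₀
  exact (abs_nonneg _).trans (h i hi)

theorem IsNDLGraph.trace_pow_le {n d : ℕ} {lam : ℝ} {G : SimpleGraph (Fin n)}
    [inst : DecidableRel G.Adj] (hG : IsNDLGraph n d lam G) (hn : 2 ≤ n) (k : ℕ) :
    (G.adjMatrix ℝ ^ (k + 2)).trace ≤ d ^ (k + 2) + lam ^ k * (n * d) := by
  have hlam := hG.lam_nonneg hn
  obtain rfl : inst = Classical.decRel G.Adj := Subsingleton.elim _ _
  let _ := Classical.decRel G.Adj
  obtain ⟨hreg, i₀, hi₀, h⟩ := hG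
  have h2 : ∑ i, G.adjHermitian.eigenvalues i ^ 2 = n * d := by
    rw [← G.adjHermitian.trace_pow_eq_sum, sq, Matrix.trace]
    refine (sum_congr rfl fun i _ => ?_).trans (?_ : ∑ _i : Fin n, (d : ℝ) = n * d)
    · rw [Matrix.diag_apply, SimpleGraph.adjMatrix_mul_self_apply_self, hreg.degree_eq]
    · simp
  rw [G.adjHermitian.trace_pow_eq_sum, ← add_sum_erase _ _ (mem_univ i₀), hi₀, ← h2, mul_sum]
  refine add_le_add le_rfl ?_
  refine (sum_le_sum fun i hi => ?_).trans
    (sum_le_sum_of_subset_of_nonneg (erase_subset _ _) fun i _ _ => by positivity)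
  rw [pow_add]
  refine mul_le_mul_of_nonneg_right ?_ (sq_nonneg _)
  refine (le_abs_self _).trans ?_
  rw [abs_pow]
  exact pow_le_pow_left₀ (abs_nonneg _) (h i (ne_of_mem_erase hi)) _

section Moments

variable {n d : ℕ} {p : ℝ} {G : SimpleGraph (Fin n)} [DecidableRel G.Adj]

theorem sum_openNeighbors (ω : Fin n → Bool) (v : Fin n) (g : Fin n → ℝ) :
    ∑ u ∈ openNeighbors G ω v, g u =
      ∑ u ∈ G.neighborFinset v, propIndicator (ω u = true) * g u := by
  rw [show openNeighbors G ω v = (G.neighborFinset v).filter (ω · = true) by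
    ext; simp [openNeighbors], sum_filter]
  refine sum_congr rfl fun u _ => ?_
  by_cases h : ω u = true <;> simp [propIndicator, h]

theorem sum_neighbors_pow_eq_trace (k : ℕ) :
    ∑ v, ∑ u ∈ G.neighborFinset v, ∑ w ∈ G.neighborFinset v, (G.adjMatrix ℝ ^ k) u w =
      (G.adjMatrix ℝ ^ (k + 2)).trace := by
  rw [pow_succ, pow_succ', Matrix.trace]
  refine sum_congr rfl fun v _ => ?_
  rw [Matrix.diag_apply, SimpleGraph.mul_adjMatrix_apply]
  refine Finset.sum_comm.trans ?_
  exact sum_congr rfl fun w _ => (SimpleGraph.adjMatrix_mul_apply _ _ _ _).symm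

/-- The expected total influence of the vertices on the excess. -/
theorem sum_percolationExp_edgesAddComponents_sub_le {lam : ℝ} (hG : IsNDLGraph n d lam G)
    (hn : 2 ≤ n) (hreg : G.IsRegularOfDegree d) (h0 : 0 ≤ p) (h1 : p ≤ 1) (M : ℕ) :
    ∑ v, percolationExp p (fun ω => edgesAddComponents (openGraph G (Function.update ω v true)) -
        edgesAddComponents (openGraph G (Function.update ω v false))) ≤
      ∑ L ∈ range (2 * M), p ^ (L + 2) * (d ^ (L + 3) + lam ^ (L + 1) * (n * d)) +
        n * (d * (p * survivalBound d p M)) ^ 2 := by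
  have hpoint : ∀ v ω, edgesAddComponents (openGraph G (Function.update ω v true)) -
      edgesAddComponents (openGraph G (Function.update ω v false)) ≤
      ∑ u ∈ G.neighborFinset v, ∑ w ∈ G.neighborFinset v,
        propIndicator ((ω u = true ∧ ω w = true) ∧
          u ≠ w ∧ (openGraph G (Function.update ω v false)).Reachable u w) := by
    intro v ω
    have h := (edgesAddComponents_update G ω v).2.2
    simp only [sum_openNeighbors, mul_sum, ← propIndicator_and, ← and_assoc] at h ⊢
    linarith
  have hE : ∀ v, percolationExp p (fun ω =>
      edgesAddComponents (openGraph G (Function.update ω v true)) -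
        edgesAddComponents (openGraph G (Function.update ω v false))) ≤
      ∑ u ∈ G.neighborFinset v, ∑ w ∈ G.neighborFinset v,
        (∑ L ∈ range (2 * M), p ^ (L + 2) * (G.adjMatrix ℝ ^ (L + 1)) u w +
          (p * survivalBound d p M) ^ 2) := by
    intro v
    refine (percolationExp_mono h0 h1 (hpoint v)).trans ?_
    rw [percolationExp_sum]
    refine sum_le_sum fun u _ => ?_
    rw [percolationExp_sum]
    exact sum_le_sum fun w _ => percolationExp_connected_le G hreg h0 h1 v u w M
  refine (sum_le_sum fun v _ => hE v).trans ?_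
  simp only [sum_add_distrib]
  refine add_le_add ?_ (le_of_eq ?_)
  · have e : ∑ v, ∑ u ∈ G.neighborFinset v, ∑ w ∈ G.neighborFinset v,
        ∑ L ∈ range (2 * M), p ^ (L + 2) * (G.adjMatrix ℝ ^ (L + 1)) u w =
        ∑ L ∈ range (2 * M), p ^ (L + 2) * (G.adjMatrix ℝ ^ (L + 1 + 2)).trace := by
      simp only [← sum_neighbors_pow_eq_trace, mul_sum]
      refine Eq.trans (sum_congr rfl fun v _ => ?_) sum_comm
      exact Eq.trans (sum_congr rfl fun u _ => sum_comm) sum_comm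
    rw [e]
    exact sum_le_sum fun L _ =>
      mul_le_mul_of_nonneg_left (hG.trace_pow_le hn (L + 1)) (pow_nonneg h0 _)
  · simp only [sum_const, SimpleGraph.card_neighborFinset_eq_degree, hreg.degree_eq, card_univ,
      Fintype.card_fin, nsmul_eq_mul]
    ring

theorem percolationExp_card_openNeighbors_sq_le (hreg : G.IsRegularOfDegree d)
    (v : Fin n) :
    percolationExp p (fun ω => (#(openNeighbors G ω v) : ℝ) ^ 2) ≤ d * p + (d * p) ^ 2 := by
  have hsq : ∀ ω : Fin n → Bool, (#(openNeighbors G ω v) : ℝ) ^ 2 =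
      ∑ u ∈ G.neighborFinset v, ∑ w ∈ G.neighborFinset v,
        propIndicator (ω u = true) * propIndicator (ω w = true) := by
    intro ω
    have := sum_openNeighbors (G := G) ω v fun _ => 1
    rw [sum_const, nsmul_eq_mul, mul_one] at this
    simp only [mul_one] at this
    rw [this, sq, sum_mul_sum]
  have hpair : ∀ u w : Fin n, percolationExp p (fun ω =>
      propIndicator (ω u = true) * propIndicator (ω w = true)) ≤
        p * propIndicator (u = w) + p * p := by
    intro u w
    by_cases h : u = w
    · subst h
      simp only [← propIndicator_and, and_self, percolationExp_open, propIndicator_of_true]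
      nlinarith
    · rw [percolationExp_open_mul u _ fun ω b => by
        rw [Function.update_of_ne (Ne.symm h)], percolationExp_open, propIndicator_of_false h]
      linarith
  simp only [hsq, percolationExp_sum]
  refine (sum_le_sum fun u _ => sum_le_sum fun w _ => hpair u w).trans ?_
  have hone : ∀ u ∈ G.neighborFinset v, ∑ w ∈ G.neighborFinset v, (p * propIndicator (u = w) + p * p)
      = p + d * (p * p) := by
    intro u hu
    rw [sum_add_distrib, ← mul_sum, sum_const, SimpleGraph.card_neighborFinset_eq_degree,
      hreg.degree_eq, nsmul_eq_mul, sum_eq_single_of_mem u hu, propIndicator_of_true rfl, mul_one]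
    exact fun w _ hw => propIndicator_of_false hw.symm
  rw [sum_congr rfl hone, sum_const, SimpleGraph.card_neighborFinset_eq_degree, hreg.degree_eq,
    nsmul_eq_mul]
  exact le_of_eq (by ring)

/-- A bound for the variance of the excess. -/
theorem percolationExp_edgesAddComponents_sq_le (hreg : G.IsRegularOfDegree d) (h0 : 0 ≤ p)
    (h1 : p ≤ 1) :
    percolationExp p (fun ω => edgesAddComponents (openGraph G ω) ^ 2) ≤
      percolationExp p (fun ω => edgesAddComponents (openGraph G ω)) ^ 2 +
        p * (n * (d * p + (d * p) ^ 2)) := by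
  refine (percolationExp_sq_le h0 h1 _).trans (add_le_add le_rfl ?_)
  have hv : ∀ v, percolationExp p (fun ω =>
      (edgesAddComponents (openGraph G (Function.update ω v true)) -
        edgesAddComponents (openGraph G (Function.update ω v false))) ^ 2) ≤
      d * p + (d * p) ^ 2 := fun v =>
    (percolationExp_mono h0 h1 fun ω => by
      obtain ⟨ha, hb, -⟩ := edgesAddComponents_update G ω v
      exact pow_le_pow_left₀ (sub_nonneg.2 ha) (by linarith) 2).trans
      (percolationExp_card_openNeighbors_sq_le hreg v)
  have hs := sum_le_sum fun v (_ : v ∈ univ) => hv v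
  rw [sum_const, card_univ, Fintype.card_fin, nsmul_eq_mul] at hs
  calc _ ≤ p * (1 - p) * (n * (d * p + (d * p) ^ 2)) :=
        mul_le_mul_of_nonneg_left hs (mul_nonneg h0 (by linarith))
    _ ≤ p * (n * (d * p + (d * p) ^ 2)) :=
        mul_le_mul_of_nonneg_right (by nlinarith) (by positivity)

end Moments

theorem percolationExp_zero {V : Type*} [Fintype V] [DecidableEq V] (f : (V → Bool) → ℝ) :
    percolationExp 0 f = f fun _ => false := by
  rw [percolationExp, sum_eq_single_of_mem (fun _ => false) (mem_univ _)]
  · simp [percolationWeight, bernoulliWeight]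
  · intro ω _ hω
    obtain ⟨v, hv⟩ := Function.ne_iff.1 hω
    rw [percolationWeight, prod_eq_zero (mem_univ v), zero_mul]
    simp [bernoulliWeight, hv]

theorem le_add_of_deriv_le_pow {F F' : ℝ → ℝ} {x C c b : ℝ} {k : ℕ} (hx : 0 ≤ x)
    (hF : ∀ s, HasDerivAt F (F' s) s)
    (hF' : ∀ s, 0 ≤ s → s ≤ x → F' s ≤ C * (b * s) ^ k + c) :
    F x ≤ F 0 + C * b ^ k * x ^ (k + 1) / (k + 1) + c * x := by
  have hd : ∀ s, HasDerivAt (fun s => C * b ^ k * s ^ (k + 1) / (k + 1) + c * s - F s)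
      (C * (b * s) ^ k + c - F' s) s := by
    intro s
    refine HasDerivAt.sub (HasDerivAt.add ?_ ?_) (hF s)
    · have := ((hasDerivAt_pow (k + 1) s).const_mul (C * b ^ k)).div_const ((k : ℝ) + 1)
      refine this.congr_deriv ?_
      rw [Nat.cast_succ, add_tsub_cancel_right, mul_pow]
      field_simp
    · simpa using (hasDerivAt_id s).const_mul c
  have hmono := monotoneOn_of_deriv_nonneg (convex_Icc 0 x)
    (fun s _ => (hd s).continuousAt.continuousWithinAt)
    (fun s _ => (hd s).differentiableAt.differentiableWithinAt)
    (fun s hs => by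
      rw [interior_Icc] at hs
      rw [(hd s).deriv]
      linarith [hF' s hs.1.le hs.2.le])
  have := hmono (Set.left_mem_Icc.2 hx) (Set.right_mem_Icc.2 hx) hx
  simp only [ne_eq, Nat.succ_ne_zero, not_false_eq_true, zero_pow, mul_zero, zero_div, add_zero,
    zero_sub] at this
  linarith

/-- A bound for the expected excess. -/
theorem percolationExp_edgesAddComponents_le {n d : ℕ} {lam ε : ℝ} {G : SimpleGraph (Fin n)}
    [DecidableRel G.Adj] (hG : IsNDLGraph n d lam G) (hreg : G.IsRegularOfDegree d)
    (hn : 2 ≤ n) (hd : 2 ≤ d) (hε : 0 < ε) (hε' : ε < 1 / 2) (hlam : lam / d ≤ ε ^ 4)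
    (hdn : (d : ℝ) ≤ ε ^ 4 * n) :
    percolationExp ((1 + ε) / d) (fun ω => edgesAddComponents (openGraph G ω)) ≤
      n + 144 * Real.exp 2 ^ 4 * ε ^ 3 * n / d := by
  have hd0 : (0 : ℝ) < d := by positivity
  have hd2 : (2 : ℝ) ≤ d := by exact_mod_cast hd
  have hn0 : (0 : ℝ) < n := by positivity
  set a : ℝ := 1 + ε with ha
  have ha1 : 1 ≤ a := by linarith
  have ha2 : a ≤ 3 / 2 := by linarith
  set p : ℝ := a / d with hp
  have hp0 : 0 ≤ p := by positivity
  have hp1 : p ≤ 1 := by rw [hp, div_le_one hd0]; linarith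
  have hdp : d * p = a := by rw [hp]; field_simp
  set m : ℕ := ⌈1 / ε⌉₊ with hm
  have hm1 : 1 / ε ≤ m := Nat.le_ceil _
  have hmε : 1 ≤ m * ε := by rwa [div_le_iff₀ hε] at hm1
  have hmε2 : m * ε ≤ 2 := by
    have h := Nat.ceil_lt_add_one (a := 1 / ε) (by positivity)
    rw [← hm] at h
    have h' := mul_le_mul_of_nonneg_right h.le hε.le
    rw [add_mul, one_div_mul_cancel hε.ne'] at h'
    linarith
  set B : ℝ := Real.exp 2 with hB
  have hB0 : 0 < B := Real.exp_pos 2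
  have ham : a ^ m ≤ B := by
    calc a ^ m ≤ Real.exp ε ^ m :=
          pow_le_pow_left₀ (by linarith) (by linarith [Real.add_one_le_exp ε]) m
      _ = Real.exp (m * ε) := (Real.exp_nat_mul ε m).symm
      _ ≤ B := Real.exp_le_exp.2 hmε2
  have ham0 : 0 ≤ a ^ m := by positivity
  set ρ : ℝ := lam / d with hρ
  have hlam0 : 0 ≤ lam := hG.lam_nonneg hn
  have hρ0 : 0 ≤ ρ := by positivity
  have hε4 : ε ^ 4 ≤ 1 := pow_le_one₀ hε.le (by linarith)
  have hlamρ : lam = ρ * d := by rw [hρ]; field_simp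
  have hderiv : ∀ s, 0 ≤ s → s ≤ p →
      ∑ v, percolationExp s (fun ω => edgesAddComponents (openGraph G (Function.update ω v true)) -
        edgesAddComponents (openGraph G (Function.update ω v false))) ≤
      64 * B ^ 2 * ε ^ 2 * n * (d * s) ^ (2 * m + 2) + 24 * B ^ 4 * ε ^ 3 * n := by
    intro s hs0 hsp
    have hs1 := hsp.trans hp1
    have hds : d * s ≤ a := hdp ▸ mul_le_mul_of_nonneg_left hsp hd0.le
    have hds0 : 0 ≤ d * s := by positivity
    refine (sum_percolationExp_edgesAddComponents_sub_le hG hn hreg hs0 hs1 (2 * m)).trans ?_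
    rw [add_comm]
    refine add_le_add ?_ ?_
    · have hsurv : survivalBound d s (2 * m) ≤ (d * s) ^ m * (8 * B * ε) := by
        rw [two_mul]
        refine (survivalBound_add_le hd hs0 hs1 (by linarith) m m).trans
          (mul_le_mul_of_nonneg_left ?_ (by positivity))
        refine (survivalBound_le hd hs0 hs1 (by linarith) ha1 hds m).trans ?_
        calc a ^ m * (8 / (m + 1)) ≤ B * (8 * ε) := by
              refine mul_le_mul ham ?_ (by positivity) hB0.le
              rw [div_le_iff₀ (by positivity)]
              nlinarith
          _ = 8 * B * ε := by ring
      have h := mul_le_mul_of_nonneg_left hsurv hds0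
      have h2 := pow_le_pow_left₀ (mul_nonneg hds0 (survivalBound_mem d hs0 hs1 _).1) h 2
      calc (n : ℝ) * (d * (s * survivalBound d s (2 * m))) ^ 2
          ≤ n * (d * s * ((d * s) ^ m * (8 * B * ε))) ^ 2 := by
            rw [← mul_assoc (d : ℝ)]
            exact mul_le_mul_of_nonneg_left h2 hn0.le
        _ = _ := by ring
    · have hterm : ∀ L ∈ range (2 * (2 * m)),
          s ^ (L + 2) * (d ^ (L + 3) + lam ^ (L + 1) * (n * d)) ≤ 3 * B ^ 4 * ε ^ 4 * n := by
        intro L hL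
        have hL' : L + 2 ≤ 4 * m + 1 := by have := mem_range.1 hL; omega
        have e : s ^ (L + 2) * (d ^ (L + 3) + lam ^ (L + 1) * (n * d)) =
            (d * s) ^ (L + 2) * (d + ρ ^ (L + 1) * n) := by
          rw [hlamρ]; ring
        rw [e]
        have h1 : (d * s) ^ (L + 2) ≤ B ^ 4 * (3 / 2) :=
          calc (d * s) ^ (L + 2) ≤ a ^ (L + 2) := pow_le_pow_left₀ hds0 hds _
            _ ≤ a ^ (4 * m + 1) := pow_le_pow_right₀ ha1 hL'
            _ = (a ^ m) ^ 4 * a := by ring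
            _ ≤ B ^ 4 * (3 / 2) :=
              mul_le_mul (pow_le_pow_left₀ ham0 ham 4) ha2 (by linarith) (by positivity)
        have h2 : ρ ^ (L + 1) ≤ ε ^ 4 :=
          (pow_le_of_le_one hρ0 (hlam.trans hε4) L.succ_ne_zero).trans hlam
        have h3 : (d : ℝ) + ρ ^ (L + 1) * n ≤ 2 * ε ^ 4 * n := by
          have := mul_le_mul_of_nonneg_right h2 hn0.le
          linarith
        calc (d * s) ^ (L + 2) * (d + ρ ^ (L + 1) * n) ≤ B ^ 4 * (3 / 2) * (2 * ε ^ 4 * n) :=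
              mul_le_mul h1 h3 (by positivity) (by positivity)
          _ = _ := by ring
      refine (sum_le_sum hterm).trans ?_
      rw [sum_const, card_range, nsmul_eq_mul]
      push_cast
      calc (2 : ℝ) * (2 * m) * (3 * B ^ 4 * ε ^ 4 * n) =
            12 * B ^ 4 * ε ^ 3 * n * (m * ε) := by ring
        _ ≤ 12 * B ^ 4 * ε ^ 3 * n * 2 := mul_le_mul_of_nonneg_left hmε2 (by positivity)
        _ = _ := by ring
  have hintegrated := le_add_of_deriv_le_pow hp0
    (fun s => hasDerivAt_percolationExp (fun ω => edgesAddComponents (openGraph G ω)) s) hderiv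
  have hzero : percolationExp 0 (fun ω => edgesAddComponents (openGraph G ω)) ≤ n := by
    rw [percolationExp_zero]
    simpa using edgesAddComponents_openGraph_false_le G
  have hT1 : 64 * B ^ 2 * ε ^ 2 * n * (d : ℝ) ^ (2 * m + 2) * p ^ (2 * m + 2 + 1) /
      ((2 * m + 2 : ℕ) + 1) ≤ 108 * B ^ 4 * ε ^ 3 * n / d := by
    rw [div_le_iff₀ (by positivity)]
    have e : 64 * B ^ 2 * ε ^ 2 * n * (d : ℝ) ^ (2 * m + 2) * p ^ (2 * m + 2 + 1) =
        64 * B ^ 2 * ε ^ 2 * n / d * ((a ^ m) ^ 2 * a ^ 3) := by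
      have : (d : ℝ) ^ (2 * m + 2) * p ^ (2 * m + 2 + 1) = (d * p) ^ (2 * m + 2) * p := by
        rw [pow_succ p, ← mul_assoc, ← mul_pow]
      rw [mul_assoc, this, hdp, hp]
      ring
    rw [e]
    have h1 : (a ^ m) ^ 2 * a ^ 3 ≤ B ^ 2 * (27 / 8) := by
      refine mul_le_mul (pow_le_pow_left₀ ham0 ham 2) ?_ (by positivity) (by positivity)
      exact (pow_le_pow_left₀ (by linarith) ha2 3).trans (by norm_num)
    calc 64 * B ^ 2 * ε ^ 2 * n / d * ((a ^ m) ^ 2 * a ^ 3)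
        ≤ 64 * B ^ 2 * ε ^ 2 * n / d * (B ^ 2 * (27 / 8)) :=
          mul_le_mul_of_nonneg_left h1 (by positivity)
      _ = 108 * B ^ 4 * ε ^ 2 * n / d * 2 := by ring
      _ ≤ 108 * B ^ 4 * ε ^ 2 * n / d * (ε * ((2 * m + 2 : ℕ) + 1)) := by
          refine mul_le_mul_of_nonneg_left ?_ (by positivity)
          push_cast
          nlinarith
      _ = _ := by ring
  have hT2 : 24 * B ^ 4 * ε ^ 3 * n * p ≤ 36 * B ^ 4 * ε ^ 3 * n / d := by
    have : p ≤ 3 / 2 / d := div_le_div_of_nonneg_right ha2 hd0.le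
    calc _ ≤ 24 * B ^ 4 * ε ^ 3 * n * (3 / 2 / d) :=
          mul_le_mul_of_nonneg_left this (by positivity)
      _ = _ := by ring
  calc _ ≤ (n : ℝ) + 108 * B ^ 4 * ε ^ 3 * n / d + 36 * B ^ 4 * ε ^ 3 * n / d := by linarith
    _ = _ := by ring

theorem bernoulliMeasure_singleton (p : ℝ) (b : Bool) :
    bernoulliMeasure p {b} = ENNReal.ofReal (bernoulliWeight p b) := by
  cases b <;> simp [bernoulliMeasure, bernoulliWeight]

instance isFiniteMeasure_bernoulliMeasure (p : ℝ) :
    MeasureTheory.IsFiniteMeasure (bernoulliMeasure p) :=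
  ⟨by simp [bernoulliMeasure]⟩

theorem percolationMeasure_eq {V : Type*} [Fintype V] [DecidableEq V] {p : ℝ} (h0 : 0 ≤ p)
    (h1 : p ≤ 1) (A : Set (V → Bool)) :
    percolationMeasure V p A =
      ENNReal.ofReal (percolationExp p fun ω => propIndicator (ω ∈ A)) := by
  classical
  have hsing : ∀ ω, percolationMeasure V p {ω} = ENNReal.ofReal (percolationWeight p ω) := by
    intro ω
    rw [percolationMeasure, MeasureTheory.Measure.pi_singleton, percolationWeight,
      ENNReal.ofReal_prod_of_nonneg fun v _ => bernoulliWeight_nonneg h0 h1 _]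
    exact prod_congr rfl fun v _ => bernoulliMeasure_singleton p _
  have hA : A = ((univ.filter (· ∈ A) : Finset (V → Bool)) : Set (V → Bool)) := by
    ext; simp
  conv_lhs => rw [hA]
  rw [← MeasureTheory.sum_measure_singleton, percolationExp]
  simp only [hsing]
  rw [← ENNReal.ofReal_sum_of_nonneg fun ω _ => percolationWeight_nonneg h0 h1 ω, sum_filter]
  congr 1
  refine sum_congr rfl fun ω _ => ?_
  by_cases h : ω ∈ A <;> simp [propIndicator, h]

open MeasureTheory in
/-- There are `ε₀ > 0` and `K > 0` such that for every `ε ∈ (0, ε₀)` and every `γ > 0`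
there are `β > 0` and `n₀` such that for all `n ≥ n₀`, all `d` with `1 + ε ≤ d ≤ β n`,
and every `(n,d,λ)`-graph `G` with `λ/d ≤ ε^{24/ε¹²}`, with probability at least
`1 - γ` the excess of the percolated subgraph `G_p` (its number of edges minus its
number of vertices plus its number of connected components) is at most `K ε³ n / d`. -/
theorem excess_of_percolated_graph :
    ∃ ε₀ > (0 : ℝ), ∃ K > (0 : ℝ), ∀ ε : ℝ, 0 < ε → ε < ε₀ →
      ∀ γ > (0 : ℝ), ∃ β > (0 : ℝ), ∃ n₀ : ℕ,
        ∀ n : ℕ, n₀ ≤ n → ∀ d : ℕ, 1 + ε ≤ (d : ℝ) → (d : ℝ) ≤ β * n →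
          ∀ (lam : ℝ) (G : SimpleGraph (Fin n)),
            IsNDLGraph n d lam G → lam / d ≤ ε ^ ((24 : ℝ) / ε ^ 12) →
              ENNReal.ofReal (1 - γ) ≤
                percolationMeasure (Fin n) ((1 + ε) / d)
                  {ω : Fin n → Bool |
                    ((G.induce (percSet ω)).edgeSet.ncard : ℝ) -
                        (percSet ω).ncard +
                        Nat.card (G.induce (percSet ω)).ConnectedComponent ≤
                      K * ε ^ 3 * n / d} := by
  refine ⟨1 / 2, by norm_num, 144 * Real.exp 2 ^ 4 + 1, by positivity, fun ε hε hε' γ hγ =>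
    ⟨min (ε ^ 4) (γ * ε ^ 6 / 6), by positivity, 0, fun n _ d hd hdn lam G hG hlam => ?_⟩⟩
  classical
  have hd1 : (1 : ℝ) < d := by linarith
  have hd2 : 2 ≤ d := by
    have : 1 < d := by exact_mod_cast hd1
    omega
  have hd0 : (0 : ℝ) < d := by linarith
  have hβ0 : 0 ≤ min (ε ^ 4) (γ * ε ^ 6 / 6) := by positivity
  have hdn4 : (d : ℝ) ≤ ε ^ 4 * n :=
    hdn.trans (mul_le_mul_of_nonneg_right (min_le_left _ _) n.cast_nonneg)
  have hdnγ : (d : ℝ) ≤ γ * ε ^ 6 / 6 * n :=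
    hdn.trans (mul_le_mul_of_nonneg_right (min_le_right _ _) n.cast_nonneg)
  have hε4 : ε ^ 4 ≤ 1 := pow_le_one₀ hε.le (by linarith)
  have hn1 : (1 : ℝ) < n := by
    have : ε ^ 4 * n ≤ 1 * n := mul_le_mul_of_nonneg_right hε4 n.cast_nonneg
    linarith
  have hn2 : 2 ≤ n := by
    have : 1 < n := by exact_mod_cast hn1
    omega
  have hn0 : (0 : ℝ) < n := by linarith
  have hlam4 : lam / d ≤ ε ^ 4 := by
    refine hlam.trans ?_
    rw [← Real.rpow_natCast ε 4]
    refine Real.rpow_le_rpow_of_exponent_ge hε (by linarith) ?_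
    rw [le_div_iff₀ (by positivity)]
    have : ε ^ 12 ≤ 1 := pow_le_one₀ hε.le (by linarith)
    push_cast
    linarith
  have hreg : G.IsRegularOfDegree d := by
    convert hG.1
  set p : ℝ := (1 + ε) / d with hp
  have hp0 : 0 ≤ p := by positivity
  have hp1 : p ≤ 1 := by rw [hp, div_le_one hd0]; exact hd
  have hdp : d * p = 1 + ε := by rw [hp]; field_simp
  have ht : 0 < ε ^ 3 * n / d := by positivity
  have hcheb := percolationExp_chebyshev hp0 hp1 _ ht
    (percolationExp_edgesAddComponents_le hG hreg hn2 hd2 hε hε' hlam4 hdn4)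
    (percolationExp_edgesAddComponents_sq_le hreg hp0 hp1)
  rw [percolationMeasure_eq hp0 hp1]
  refine ENNReal.ofReal_le_ofReal ((le_trans ?_ hcheb).trans
    (percolationExp_mono hp0 hp1 fun ω => propIndicator_mono fun h => ?_))
  · refine sub_le_sub_left ?_ 1
    rw [div_le_iff₀ (by positivity), hdp]
    have h6 : p * (n * (1 + ε + (1 + ε) ^ 2)) ≤ 6 * n / d := by
      have hpoly : (1 + ε) * (1 + ε + (1 + ε) ^ 2) ≤ 6 := by nlinarith [sq_nonneg ε]
      calc (p * (n * (1 + ε + (1 + ε) ^ 2)) : ℝ) = n / d * ((1 + ε) * (1 + ε + (1 + ε) ^ 2)) := by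
            rw [hp]; ring
        _ ≤ n / d * 6 := mul_le_mul_of_nonneg_left hpoly (by positivity)
        _ = _ := by ring
    refine h6.trans ?_
    calc (6 : ℝ) * n / d = 6 * n / d ^ 2 * d := by field_simp
      _ ≤ 6 * n / d ^ 2 * (γ * ε ^ 6 / 6 * n) := mul_le_mul_of_nonneg_left hdnγ (by positivity)
      _ = γ * (ε ^ 3 * n / d) ^ 2 := by ring
  · have hexc := excess_induce_le G ω
    rw [Fintype.card_fin] at hexc
    refine hexc.trans ?_
    calc edgesAddComponents (openGraph G ω) - n
        ≤ 144 * Real.exp 2 ^ 4 * ε ^ 3 * n / d + ε ^ 3 * n / d := by linarith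
      _ = _ := by ring
end

section
/- There exist constants ε > 0 and δ₁, δ₃ > 0 such that the following holds for all positive integers n and d. If G is an (n,d,λ)-graph with d ≤ δ₃·n and λ/d ≤ δ₁, then G contains an induced path P on at least ε²n/(3d) vertices whose vertex set satisfies |N_G(V(P))| ≥ ε²n/3 − ε⁴n, where N_G(V(P)) is the external neighbourhood of V(P) in G. -/
open Finset



/-- The external neighbourhood of `S` in `G`. -/
def extNbhd {V : Type*} (G : SimpleGraph V) (S : Set V) : Set V :=
  {v : V | v ∉ S ∧ ∃ u ∈ S, G.Adj u v}


/-- On vectors with zero coordinate sum, a Hermitian matrix with constant row sum `d` stretches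
by at most its second largest absolute eigenvalue. -/
theorem Matrix.IsHermitian.sum_mulVec_sq_le {ι : Type*} [Fintype ι] [DecidableEq ι]
    {A : Matrix ι ι ℝ} (hA : A.IsHermitian) {d L : ℝ} (hLd : L < d)
    (hone : A.mulVec 1 = d • 1) {i₀ : ι} (hL : ∀ i, i ≠ i₀ → |hA.eigenvalues i| ≤ L)
    {x : ι → ℝ} (hx : ∑ v, x v = 0) :
    ∑ v, (A.mulVec x v) ^ 2 ≤ L ^ 2 * ∑ v, x v ^ 2 := by
  set b := hA.eigenvectorBasis with hb
  have key : ∀ i (y : ι → ℝ), inner ℝ (b i) (WithLp.toLp 2 (A.mulVec y)) =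
      hA.eigenvalues i * inner ℝ (b i) (WithLp.toLp 2 y) := by
    intro i y
    have h1 : ∀ z : ι → ℝ, inner ℝ (b i) (WithLp.toLp 2 z) = (b i).ofLp ⬝ᵥ z := by
      intro z
      simp [EuclideanSpace.inner_eq_star_dotProduct, dotProduct_comm]
    rw [h1, h1, Matrix.dotProduct_mulVec, ← Matrix.mulVec_transpose]
    have h2 : A.transpose = A := by
      simpa [Matrix.conjTranspose_eq_transpose_of_trivial] using hA.eq
    rw [h2, hb, hA.mulVec_eigenvectorBasis, smul_dotProduct, smul_eq_mul]
  have parseval : ∀ y : ι → ℝ, ∑ v, y v ^ 2 = ∑ i, inner ℝ (b i) (WithLp.toLp 2 y) ^ 2 := by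
    intro y
    have := b.sum_sq_norm_inner_right (WithLp.toLp 2 y)
    simpa [EuclideanSpace.norm_sq_eq] using this.symm
  have hzero : ∀ i, i ≠ i₀ → inner ℝ (b i) (WithLp.toLp 2 (1 : ι → ℝ)) = 0 := by
    intro i hi
    have h := key i 1
    rw [hone, WithLp.toLp_smul, inner_smul_right] at h
    have h3 := (le_abs_self _).trans (hL i hi)
    have h4 : (d - hA.eigenvalues i) * inner ℝ (b i) (WithLp.toLp 2 (1 : ι → ℝ)) = 0 := by
      linear_combination h
    rcases mul_eq_zero.1 h4 with h5 | h5
    · linarith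
    · exact h5
  have hx0 : inner ℝ (b i₀) (WithLp.toLp 2 x) = 0 := by
    have h := b.sum_inner_mul_inner (WithLp.toLp 2 (1 : ι → ℝ)) (WithLp.toLp 2 x)
    rw [Finset.sum_eq_single i₀ (fun i _ hi => by rw [real_inner_comm, hzero i hi, zero_mul])
      (by simp)] at h
    have hp := (parseval 1).symm
    rw [Finset.sum_eq_single i₀ (fun i _ hi => by rw [hzero i hi]; simp) (by simp)] at hp
    have h6 : inner ℝ (WithLp.toLp 2 (1 : ι → ℝ)) (WithLp.toLp 2 x) = 0 := by
      simpa [EuclideanSpace.inner_eq_star_dotProduct, dotProduct] using hx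
    rw [h6] at h
    rcases mul_eq_zero.1 h with h5 | h5
    · rw [real_inner_comm] at h5
      rw [h5] at hp
      have : Nonempty ι := ⟨i₀⟩
      simp [Fintype.card_ne_zero, eq_comm] at hp
    · exact h5
  rw [parseval, parseval x, Finset.mul_sum]
  refine Finset.sum_le_sum fun i _ => ?_
  rw [key, mul_pow]
  by_cases hi : i = i₀
  · simp [hi, hx0]
  · exact mul_le_mul_of_nonneg_right (sq_le_sq' (neg_le_of_abs_le (hL i hi))
      (le_of_abs_le (hL i hi))) (sq_nonneg _)

namespace SimpleGraph

variable {V : Type*} [Fintype V] [DecidableEq V] (G : SimpleGraph V) [DecidableRel G.Adj]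

/-- The closed neighbourhood of a finite set of vertices. -/
def closedNbhd (X : Finset V) : Finset V :=
  X.biUnion fun v => insert v (G.neighborFinset v)

variable {G}

theorem mem_closedNbhd_of_adj {X : Finset V} {u w : V} (hu : u ∈ X) (h : G.Adj u w) :
    w ∈ G.closedNbhd X :=
  mem_biUnion.2 ⟨u, hu, mem_insert_of_mem ((G.mem_neighborFinset _ _).2 h)⟩

theorem closedNbhd_mono {X Y : Finset V} (h : X ⊆ Y) : G.closedNbhd X ⊆ G.closedNbhd Y :=
  biUnion_subset_biUnion_of_subset_left _ h

theorem IsRegularOfDegree.card_closedNbhd_le {d : ℕ} (hG : G.IsRegularOfDegree d)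
    (X : Finset V) : #(G.closedNbhd X) ≤ #X * (d + 1) := by
  refine card_biUnion_le_card_mul _ _ _ fun v _ => (card_insert_le _ _).trans ?_
  rw [card_neighborFinset_eq_degree, hG v]

variable (G) in
/-- The vertices with more than `d / 2` neighbours within distance one of `X`. -/
def crowded (d : ℕ) (X : Finset V) : Finset V :=
  {w | d < 2 * #(G.neighborFinset w ∩ G.closedNbhd X)}

theorem crowded_mono {d : ℕ} {X Y : Finset V} (h : X ⊆ Y) :
    G.crowded d X ⊆ G.crowded d Y := by
  intro w hw
  simp only [crowded, mem_filter, mem_univ, true_and] at hw ⊢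
  exact hw.trans_le (Nat.mul_le_mul_left _
    (card_le_card (inter_subset_inter_left (closedNbhd_mono h))))

variable (G) in
/-- A state of the depth-first search for an induced path: `P` is the current path, tip first,
`D` is the set of abandoned vertices, and each visited vertex `v` owns a set `A v` of at least
`d / 2` neighbours, from which its successors on the path are chosen. -/
structure InducedSearch (d : ℕ) (P : List V) (D : Finset V) (A : V → Finset V) : Prop where
  path : ∀ i j (hi : i < P.length) (hj : j < P.length), i < j → (G.Adj P[i] P[j] ↔ i + 1 = j)
  nodup : P.Nodup
  notMem : ∀ v ∈ P, v ∉ D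
  subset : ∀ v ∈ P.toFinset ∪ D, A v ⊆ G.neighborFinset v
  disjoint : ∀ u ∈ P.toFinset ∪ D, ∀ v ∈ P.toFinset ∪ D, u ≠ v → Disjoint (A u) (A v)
  card_le : ∀ v ∈ P.toFinset ∪ D, d ≤ 2 * #(A v)
  dead : ∀ v ∈ D, A v ⊆ G.crowded d (P.toFinset ∪ D) ∪ (P.toFinset ∪ D)
  avoid : P.Pairwise fun v u => ∀ w ∈ A v, ¬ G.Adj u w

namespace InducedSearch

variable {d : ℕ} {P : List V} {D : Finset V} {A : V → Finset V}

theorem nil (A : V → Finset V) : G.InducedSearch d [] ∅ A := by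
  constructor <;> simp

theorem pop {v : V} (h : G.InducedSearch d (v :: P) D A)
    (hv : A v ⊆ G.crowded d ((v :: P).toFinset ∪ D) ∪ ((v :: P).toFinset ∪ D)) :
    G.InducedSearch d P (insert v D) A := by
  have hX : P.toFinset ∪ insert v D = (v :: P).toFinset ∪ D := by
    ext; simp
  have hnd := List.nodup_cons.1 h.nodup
  refine ⟨fun i j hi hj hij => ?_, hnd.2, fun u hu => ?_, ?_, ?_, ?_, ?_,
    (List.pairwise_cons.1 h.avoid).2⟩
  · exact (h.path (i + 1) (j + 1) (Nat.succ_lt_succ hi) (Nat.succ_lt_succ hj)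
      (Nat.succ_lt_succ hij)).trans (by omega)
  · rw [mem_insert, not_or]
    exact ⟨fun e => hnd.1 (e ▸ hu), h.notMem u (List.mem_cons_of_mem _ hu)⟩
  · rw [hX]; exact h.subset
  · rw [hX]; exact h.disjoint
  · rw [hX]; exact h.card_le
  · rw [hX]
    intro u hu
    rcases mem_insert.1 hu with rfl | hu
    · exact hv
    · exact h.dead u hu

theorem push (hG : G.IsRegularOfDegree d) (h : G.InducedSearch d P D A) {w : V}
    (hw : w ∉ P.toFinset ∪ D) (hc : w ∉ G.crowded d (P.toFinset ∪ D))
    (hadj : ∀ i (hi : i < P.length), G.Adj w P[i] ↔ i = 0) :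
    G.InducedSearch d (w :: P) D
      (Function.update A w (G.neighborFinset w \ G.closedNbhd (P.toFinset ∪ D))) := by
  set X := P.toFinset ∪ D with hXdef
  have hX : (w :: P).toFinset ∪ D = insert w X := by
    ext; simp [hXdef]
  have hne : ∀ v ∈ X, v ≠ w := fun v hv e => hw (e ▸ hv)
  have hPX : ∀ v ∈ P, v ∈ X := fun v hv => by simp [hXdef, hv]
  have hDX : ∀ v ∈ D, v ∈ X := fun v hv => by simp [hXdef, hv]
  have hsub : ∀ v ∈ X, A v ⊆ G.closedNbhd X := fun v hv z hz =>
    mem_closedNbhd_of_adj hv ((G.mem_neighborFinset _ _).1 (h.subset v hv hz))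
  refine ⟨fun i j hi hj hij => ?_, ?_, ?_, ?_, ?_, ?_, ?_, ?_⟩
  · obtain ⟨j, rfl⟩ : ∃ j', j = j' + 1 := ⟨j - 1, by omega⟩
    rcases i with _ | i
    · simpa [eq_comm] using hadj j (by simpa using hj)
    · simpa using h.path i j (by simpa using hi) (by simpa using hj) (by omega)
  · exact List.nodup_cons.2 ⟨fun hwP => hw (hPX w hwP), h.nodup⟩
  · intro v hv
    rcases List.mem_cons.1 hv with rfl | hv
    · exact fun hD => hw (hDX _ hD)
    · exact h.notMem v hv
  · rw [hX]
    intro v hv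
    rcases mem_insert.1 hv with rfl | hv
    · simp
    · rw [Function.update_of_ne (hne v hv)]
      exact h.subset v hv
  · rw [hX]
    intro u hu v hv huv
    rcases mem_insert.1 hu with rfl | huX <;> rcases mem_insert.1 hv with rfl | hvX
    · exact absurd rfl huv
    · rw [Function.update_self, Function.update_of_ne (hne v hvX)]
      exact disjoint_of_subset_right (hsub v hvX) sdiff_disjoint
    · rw [Function.update_self, Function.update_of_ne (hne u huX)]
      exact disjoint_of_subset_left (hsub u huX) disjoint_sdiff
    · rw [Function.update_of_ne (hne v hvX), Function.update_of_ne (hne u huX)]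
      exact h.disjoint u huX v hvX huv
  · rw [hX]
    intro v hv
    rcases mem_insert.1 hv with rfl | hv
    · rw [Function.update_self]
      have h1 := card_sdiff_add_card_inter (G.neighborFinset v) (G.closedNbhd X)
      rw [card_neighborFinset_eq_degree, hG v] at h1
      simp only [crowded, mem_filter, mem_univ, true_and, not_lt] at hc
      omega
    · rw [Function.update_of_ne (hne v hv)]
      exact h.card_le v hv
  · rw [hX]
    intro v hv
    rw [Function.update_of_ne (hne v (hDX v hv))]
    exact (h.dead v hv).trans
      (union_subset_union (crowded_mono (subset_insert _ _)) (subset_insert _ _))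
  · refine List.pairwise_cons.2 ⟨fun u hu z hz huz => ?_, ?_⟩
    · rw [Function.update_self] at hz
      exact (mem_sdiff.1 hz).2 (mem_closedNbhd_of_adj (hPX u hu) huz)
    · refine h.avoid.imp_of_mem fun {v u} hv _ hvu => ?_
      rw [Function.update_of_ne (hne v (hPX v hv))]
      exact hvu

theorem exists_push (hG : G.IsRegularOfDegree d) {v : V} (h : G.InducedSearch d (v :: P) D A)
    (hv : ¬ A v ⊆ G.crowded d ((v :: P).toFinset ∪ D) ∪ ((v :: P).toFinset ∪ D)) :
    ∃ w A', G.InducedSearch d (w :: v :: P) D A' := by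
  obtain ⟨w, hwA, hw⟩ := not_subset.1 hv
  rw [mem_union, not_or] at hw
  refine ⟨w, _, h.push hG hw.2 hw.1 fun i hi => ?_⟩
  rcases i with _ | i
  · simpa [G.adj_comm] using h.subset v (by simp) hwA
  · have := (List.pairwise_cons.1 h.avoid).1 (P[i]'(by simpa using hi)) (List.getElem_mem _) w hwA
    simpa [G.adj_comm] using this

/-- Abandoned vertices own disjoint sets of vertices that are crowded or visited. -/
theorem mul_card_dead_le (h : G.InducedSearch d P D A) :
    d * #D ≤ 2 * (#(G.crowded d (P.toFinset ∪ D)) + (P.length + #D)) := by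
  have h1 : #(D.biUnion A) = ∑ v ∈ D, #(A v) :=
    card_biUnion fun u hu v hv huv =>
      h.disjoint u (mem_union_right _ hu) v (mem_union_right _ hv) huv
  have h2 : #(D.biUnion A) ≤ _ := card_le_card (biUnion_subset.2 h.dead)
  have h3 : #D * d ≤ ∑ v ∈ D, 2 * #(A v) := by
    rw [← smul_eq_mul]
    exact card_nsmul_le_sum _ _ _ fun v hv => h.card_le v (mem_union_right _ hv)
  rw [← mul_sum, ← h1] at h3
  have h4 := card_union_le (G.crowded d (P.toFinset ∪ D)) (P.toFinset ∪ D)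
  have h5 := card_union_le P.toFinset D
  have h6 := P.toFinset_card_le
  rw [mul_comm]
  omega

theorem mul_length_le_card_extNbhd (h : G.InducedSearch d P D A) :
    d * P.length ≤ 2 * ((extNbhd G {v | v ∈ P}).ncard + P.length) := by
  have h0 : #P.toFinset = P.length := List.toFinset_card_of_nodup h.nodup
  have h1 : #(P.toFinset.biUnion A) = ∑ v ∈ P.toFinset, #(A v) :=
    card_biUnion fun u hu v hv huv =>
      h.disjoint u (mem_union_left _ hu) v (mem_union_left _ hv) huv
  have h3 : #P.toFinset * d ≤ ∑ v ∈ P.toFinset, 2 * #(A v) := by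
    rw [← smul_eq_mul]
    exact card_nsmul_le_sum _ _ _ fun v hv => h.card_le v (mem_union_left _ hv)
  rw [← mul_sum, ← h1, h0] at h3
  have h4 : ((P.toFinset.biUnion A \ P.toFinset : Finset V) : Set V) ⊆
      extNbhd G {v | v ∈ P} := by
    intro z hz
    rw [mem_coe, mem_sdiff, mem_biUnion] at hz
    obtain ⟨⟨u, hu, hzu⟩, hzP⟩ := hz
    exact ⟨by simpa using hzP, u, by simpa using hu,
      (G.mem_neighborFinset _ _).1 (h.subset u (mem_union_left _ hu) hzu)⟩
  have h5 := Set.ncard_le_ncard h4 (Set.toFinite _)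
  rw [Set.ncard_coe_finset] at h5
  have h6 := le_card_sdiff P.toFinset (P.toFinset.biUnion A)
  rw [mul_comm]
  omega

/-- If few vertices are crowded by small sets, the search finds a path of any given length
`k` that leaves room for the abandoned vertices. -/
theorem exists_length_eq (hG : G.IsRegularOfDegree d) {k M : ℕ}
    (hM : ∀ X : Finset V, #X ≤ M → #(G.crowded d X) + #X < Fintype.card V)
    (hD : ∀ X : Finset V, #X ≤ M → ∀ D ⊆ X,
      d * #D ≤ 2 * (#(G.crowded d X) + M) → k + #D < M) :
    ∃ P D A, G.InducedSearch d P D A ∧ P.length = k := by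
  by_contra! hcon
  have hstep : ∀ t, ∃ P D A, G.InducedSearch d P D A ∧ P.length < k ∧
      P.length + #D ≤ M ∧ P.length + 2 * #D = t := by
    intro t
    induction t with
    | zero =>
      have h0 := nil (G := G) (d := d) fun _ => ∅
      exact ⟨[], ∅, _, h0, (Nat.zero_le _).lt_of_ne (hcon _ _ _ h0), by simp, by simp⟩
    | succ t ih =>
      obtain ⟨P, D, A, h, hPk, hPM, ht⟩ := ih
      have hXM : #(P.toFinset ∪ D) ≤ M :=
        (card_union_le _ _).trans ((Nat.add_le_add_right P.toFinset_card_le _).trans hPM)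
      have hlt := hD _ hXM D subset_union_right (h.mul_card_dead_le.trans (by omega))
      have done : ∀ w A', G.InducedSearch d (w :: P) D A' → ∃ P D A, G.InducedSearch d P D A ∧
          P.length < k ∧ P.length + #D ≤ M ∧ P.length + 2 * #D = t + 1 := by
        intro w A' h'
        have := hcon _ _ _ h'
        simp only [List.length_cons] at this
        exact ⟨_, _, _, h', by simp; omega, by simp; omega, by simp; omega⟩
      rcases P with _ | ⟨v, P⟩
      · obtain ⟨w, -, hw⟩ := exists_mem_notMem_of_card_lt_card
          (((card_union_le _ _).trans_lt (hM _ hXM)).trans_eq (card_univ (α := V)).symm)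
        rw [mem_union, not_or] at hw
        exact done w _ (h.push hG hw.2 hw.1 fun i hi => by simp at hi)
      · by_cases hv : A v ⊆ G.crowded d ((v :: P).toFinset ∪ D) ∪ ((v :: P).toFinset ∪ D)
        · have hvD := card_insert_of_notMem (h.notMem v (by simp))
          simp only [List.length_cons] at hPk hPM ht
          exact ⟨_, _, _, h.pop hv, by omega, by omega, by omega⟩
        · obtain ⟨w, A', h'⟩ := h.exists_push hG hv
          exact done w A' h'
  obtain ⟨P, D, A, -, -, h1, h2⟩ := hstep (2 * M + 1)
  omega

end InducedSearch

end SimpleGraph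

namespace SimpleGraph

/-- In a regular graph with spectral gap, a vertex set `S` is distributed nearly evenly among
the neighbourhoods. -/
theorem IsRegularOfDegree.sum_card_inter_sub_sq_le {V : Type*} [Fintype V] [DecidableEq V]
    {G : SimpleGraph V} [DecidableRel G.Adj] {d : ℕ} (hG : G.IsRegularOfDegree d)
    (hA : (G.adjMatrix ℝ).IsHermitian) {L : ℝ} (hLd : L < d) {i₀ : V}
    (hL : ∀ i, i ≠ i₀ → |hA.eigenvalues i| ≤ L) (S : Finset V) :
    ∑ w, ((#(G.neighborFinset w ∩ S) : ℝ) - d * (#S / Fintype.card V)) ^ 2 ≤ L ^ 2 * #S := by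
  have : Nonempty V := ⟨i₀⟩
  have hn : (0 : ℝ) < Fintype.card V := by exact_mod_cast Fintype.card_pos
  set s : ℝ := #S / Fintype.card V with hs
  have hsn : Fintype.card V * s = #S := by rw [hs]; field_simp
  have hs0 : 0 ≤ s := by positivity
  let x : V → ℝ := fun v => (if v ∈ S then 1 else 0) - s
  have hone : (G.adjMatrix ℝ).mulVec 1 = (d : ℝ) • 1 := by
    ext v
    simp [adjMatrix_mulVec_apply, hG v]
  have hx : ∑ v, x v = 0 := by
    simp [x, sum_sub_distrib, hsn]
  have hAx : ∀ w, (G.adjMatrix ℝ).mulVec x w = (#(G.neighborFinset w ∩ S) : ℝ) - d * s := by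
    intro w
    simp [adjMatrix_mulVec_apply, x, sum_sub_distrib, hG w]
  have hxx : ∑ v, x v ^ 2 ≤ #S := by
    have : ∀ v, x v ^ 2 = (if v ∈ S then 1 else 0) * (1 - 2 * s) + s ^ 2 := by
      intro v
      by_cases h : v ∈ S
      · simp [x, h]
        ring
      · simp [x, h]
    simp only [this, sum_add_distrib, ← sum_mul, sum_ite_mem, univ_inter, sum_const, nsmul_eq_mul,
      mul_one, card_univ]
    nlinarith [mul_nonneg (Nat.cast_nonneg (α := ℝ) #S) hs0]
  have h := hA.sum_mulVec_sq_le hLd hone hL hx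
  simp only [hAx] at h
  exact h.trans (mul_le_mul_of_nonneg_left hxx (sq_nonneg _))

section Pseudorandom

variable {V : Type*} [Fintype V] [DecidableEq V] {G : SimpleGraph V} [DecidableRel G.Adj] {d : ℕ}

theorem IsRegularOfDegree.card_crowded_le (hG : G.IsRegularOfDegree d) (hd : 0 < d)
    (hmix : ∀ S : Finset V, ∑ w, ((#(G.neighborFinset w ∩ S) : ℝ) -
      d * (#S / Fintype.card V)) ^ 2 ≤ (d / 100 : ℝ) ^ 2 * #S)
    {X : Finset V} (hX : 4 * (#X * (d + 1)) ≤ Fintype.card V) :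
    2500 * #(G.crowded d X) ≤ Fintype.card V := by
  rcases (Fintype.card V).eq_zero_or_pos with h0 | h0
  · have := card_le_univ (G.crowded d X)
    omega
  have hn : (0 : ℝ) < Fintype.card V := by exact_mod_cast h0
  have hd' : (0 : ℝ) < d := by exact_mod_cast hd
  set S := G.closedNbhd X
  have hSn : 4 * (#S : ℝ) ≤ Fintype.card V := by
    exact_mod_cast (Nat.mul_le_mul_left 4 (hG.card_closedNbhd_le X)).trans hX
  have hSd : (#S : ℝ) / Fintype.card V ≤ 1 / 4 := by
    rw [div_le_iff₀ hn]
    linarith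
  have h1 : #(G.crowded d X) • ((d : ℝ) / 4) ^ 2 ≤ ∑ w ∈ G.crowded d X,
      ((#(G.neighborFinset w ∩ S) : ℝ) - d * (#S / Fintype.card V)) ^ 2 := by
    refine card_nsmul_le_sum _ _ _ fun w hw => ?_
    have hw' : (d : ℝ) < 2 * #(G.neighborFinset w ∩ S) := by
      exact_mod_cast (mem_filter.1 hw).2
    refine pow_le_pow_left₀ (by positivity) ?_ 2
    nlinarith
  have h2 := (h1.trans (sum_le_univ_sum_of_nonneg fun w => sq_nonneg _)).trans (hmix S)
  rw [nsmul_eq_mul] at h2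
  have h3 : (d : ℝ) ^ 2 * (2500 * #(G.crowded d X)) ≤ (d : ℝ) ^ 2 * Fintype.card V := by
    nlinarith [mul_le_mul_of_nonneg_left hSn (sq_nonneg (d : ℝ))]
  exact_mod_cast le_of_mul_le_mul_left h3 (by positivity)

theorem IsRegularOfDegree.le_degree_of_pseudorandom (hG : G.IsRegularOfDegree d) (hd : 0 < d)
    [Nonempty V] (hdn : 1000 * d ≤ Fintype.card V)
    (hmix : ∀ S : Finset V, ∑ w, ((#(G.neighborFinset w ∩ S) : ℝ) -
      d * (#S / Fintype.card V)) ^ 2 ≤ (d / 100 : ℝ) ^ 2 * #S) :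
    9000 ≤ d := by
  have hn : (0 : ℝ) < Fintype.card V := by exact_mod_cast Fintype.card_pos
  have hd' : (0 : ℝ) < d := by exact_mod_cast hd
  have hdn' : 1000 * (d : ℝ) ≤ Fintype.card V := by exact_mod_cast hdn
  obtain ⟨v⟩ := ‹Nonempty V›
  have hv := hmix {v}
  have h1 : #(G.neighborFinset v) • (999 / 1000 : ℝ) ^ 2 ≤ ∑ w ∈ G.neighborFinset v,
      ((#(G.neighborFinset w ∩ {v}) : ℝ) - d * (#{v} / Fintype.card V)) ^ 2 := by
    refine card_nsmul_le_sum _ _ _ fun w hw => ?_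
    have hvw : v ∈ G.neighborFinset w := by
      simpa [G.adj_comm] using hw
    rw [inter_singleton_of_mem hvw, card_singleton]
    refine pow_le_pow_left₀ (by positivity) ?_ 2
    have : (d : ℝ) * ((1 : ℕ) / Fintype.card V) ≤ 1 / 1000 := by
      rw [Nat.cast_one, mul_one_div, div_le_iff₀ hn]
      linarith
    push_cast at this ⊢
    linarith
  have h2 := (h1.trans (sum_le_univ_sum_of_nonneg fun w => sq_nonneg _)).trans hv
  rw [card_neighborFinset_eq_degree, hG v, nsmul_eq_mul, card_singleton] at h2
  have h3 : (d : ℝ) * 9000 ≤ d * d := by nlinarith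
  exact_mod_cast le_of_mul_le_mul_left h3 hd'

theorem IsRegularOfDegree.exists_inducedSearch (hG : G.IsRegularOfDegree d) (hd : 0 < d)
    [Nonempty V] (hdn : 1000 * d ≤ Fintype.card V)
    (hmix : ∀ S : Finset V, ∑ w, ((#(G.neighborFinset w ∩ S) : ℝ) -
      d * (#S / Fintype.card V)) ^ 2 ≤ (d / 100 : ℝ) ^ 2 * #S) :
    ∃ P D A, G.InducedSearch d P D A ∧ P.length = ⌈(Fintype.card V : ℝ) / (12 * d)⌉₊ := by
  have h9 := hG.le_degree_of_pseudorandom hd hdn hmix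
  set n := Fintype.card V
  have hn0 : 0 < n := Fintype.card_pos
  have hd' : (0 : ℝ) < d := by exact_mod_cast hd
  set M := n / (5 * d)
  have hMn : M * (5 * d) ≤ n := Nat.div_mul_le_self _ _
  have hMbig : M * 45000 ≤ n := (Nat.mul_le_mul_left M (by omega)).trans hMn
  have hsmall : ∀ X : Finset V, #X ≤ M → 2500 * #(G.crowded d X) ≤ n := fun X hX =>
    hG.card_crowded_le hd hmix (by nlinarith)
  refine InducedSearch.exists_length_eq hG (M := M) (fun X hX => ?_) fun X hX D _ hD => ?_
  · have := hsmall X hX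
    omega
  · have hc := hsmall X hX
    have hD' : (1000 * #D) * d ≤ n := by nlinarith
    have hDr : (1000 * #D : ℝ) ≤ n / d := by
      rw [le_div_iff₀ hd']
      exact_mod_cast hD'
    have hr : (1000 : ℝ) ≤ n / d := by
      rw [le_div_iff₀ hd']
      exact_mod_cast hdn
    have hk : (⌈(n : ℝ) / (12 * d)⌉₊ : ℝ) < n / (12 * d) + 1 := Nat.ceil_lt_add_one (by positivity)
    have hM : (n : ℝ) / (5 * d) < M + 1 := by
      rw [div_lt_iff₀ (by positivity)]
      exact_mod_cast Nat.lt_mul_of_div_lt (Nat.lt_succ_self _) (by positivity)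
    have e1 : (n : ℝ) / (12 * d) = n / d / 12 := by rw [div_div, mul_comm]
    have e2 : (n : ℝ) / (5 * d) = n / d / 5 := by rw [div_div, mul_comm]
    rw [e1] at hk ⊢
    rw [e2] at hM
    have : ((⌈(n : ℝ) / d / 12⌉₊ : ℝ) + #D) < M := by linarith
    exact_mod_cast this

end Pseudorandom

end SimpleGraph

/-- There are constants `ε, δ₁, δ₃ > 0` such that every `(n,d,λ)`-graph `G` with
`d ≤ δ₃ n` and `λ/d ≤ δ₁` contains an induced path `P` on at least `ε² n/(3d)`
vertices whose vertex set satisfies `|N_G(V(P))| ≥ ε² n / 3 - ε⁴ n`. -/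
theorem induced_path_with_large_neighbourhood :
    ∃ ε > (0 : ℝ), ∃ δ₁ > (0 : ℝ), ∃ δ₃ > (0 : ℝ),
      ∀ (n d : ℕ), 0 < n → 0 < d →
        ∀ (lam : ℝ) (G : SimpleGraph (Fin n)),
          IsNDLGraph n d lam G → (d : ℝ) ≤ δ₃ * n → lam / d ≤ δ₁ →
            ∃ k : ℕ, ε ^ 2 * n / (3 * d) ≤ (k : ℝ) ∧
              ∃ f : Fin k → Fin n, Function.Injective f ∧
                (∀ i j : Fin k, G.Adj (f i) (f j) ↔
                  ((i : ℕ) + 1 = (j : ℕ) ∨ (j : ℕ) + 1 = (i : ℕ))) ∧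
                ε ^ 2 * n / 3 - ε ^ 4 * n ≤ ((extNbhd G (Set.range f)).ncard : ℝ) := by
  refine ⟨1 / 2, by norm_num, 1 / 100, by norm_num, 1 / 1000, by norm_num, ?_⟩
  intro n d hn hd lam G hNDL hdn hlam
  let := Classical.decRel G.Adj
  obtain ⟨hG, i₀, -, hL⟩ := hNDL
  have hd' : (0 : ℝ) < d := by exact_mod_cast hd
  have : Nonempty (Fin n) := ⟨i₀⟩
  have hdn' : 1000 * d ≤ Fintype.card (Fin n) := by
    rw [Fintype.card_fin]
    have : 1000 * (d : ℝ) ≤ n := by linarith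
    exact_mod_cast this
  have hlam' : lam ≤ d / 100 := by
    rw [div_le_iff₀ hd'] at hlam
    linarith
  have hmix := hG.sum_card_inter_sub_sq_le G.adjHermitian (L := d / 100) (by linarith)
    fun i hi => (hL i hi).trans hlam'
  have h9 : (9000 : ℝ) ≤ d := by
    exact_mod_cast hG.le_degree_of_pseudorandom hd hdn' hmix
  obtain ⟨P, D, A, h, hP⟩ := hG.exists_inducedSearch hd hdn' hmix
  have hlen : (n : ℝ) / (12 * d) ≤ P.length := by
    rw [hP, Fintype.card_fin]
    exact Nat.le_ceil _
  refine ⟨P.length, ?_, P.get, List.nodup_iff_injective_get.1 h.nodup, fun i j => ?_, ?_⟩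
  · convert hlen using 1
    field_simp
    norm_num
  · rcases lt_trichotomy (i : ℕ) j with hij | hij | hij
    · refine (h.path i j i.2 j.2 hij).trans ?_
      omega
    · obtain rfl := Fin.ext hij
      simp
    · rw [G.adj_comm]
      refine (h.path j i j.2 i.2 hij).trans ?_
      omega
  · rw [Set.range_list_get]
    have hN : (d : ℝ) * P.length ≤ 2 * ((extNbhd G {v | v ∈ P}).ncard + P.length) := by
      exact_mod_cast h.mul_length_le_card_extNbhd
    rw [div_le_iff₀ (by positivity)] at hlen
    have h4 : 4 * (P.length : ℝ) ≤ d * P.length := by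
      gcongr
      linarith
    linarith
end
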